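/- arXiv:2507.20416 — 2 statements merged into one kernel-verified Lean document; each statement's English description precedes it below -/
import Mathlib

section
/- Let k ≥ 2, n = k(k+1)/2, and let α be an n-tuple of pairwise independent irrational numbers with k(α) = k. Then there exists T > 1 such that for all t_0 ≥ T and all i ∈ ℕ₀, v_α(t_{i+1}) = π(v_α(t_i)), where {t_i} is the sequence of moments of permutation changes starting from t_0. -/
/-- Distance from `x` to the nearest integer. -/
noncomputable def distToInt (x : ℝ) : ℝ := |x - round x|

/-- The irrationality measure function `ψ_α(t) = min_{1 ≤ q ≤ t} ‖qα‖`. -/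
noncomputable def psi (α : ℝ) (t : ℝ) : ℝ :=
  sInf ((fun q : ℤ => distToInt ((q : ℝ) * α)) '' {q : ℤ | 1 ≤ q ∧ (q : ℝ) ≤ t})

/-- An `n`-tuple is pairwise independent if eventually all the values
`ψ_{α_i}(t)` are pairwise distinct. -/
def PairwiseIndependent {n : ℕ} (α : Fin n → ℝ) : Prop :=
  ∃ T : ℝ, 0 ≤ T ∧ ∀ t : ℝ, T ≤ t → ∀ i j : Fin n, i ≠ j → psi (α i) t ≠ psi (α j) t

/-- `v : Fin n → Fin n` is the order vector of `α` at time `t`: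
`ψ_{α_{v 0}}(t) > ψ_{α_{v 1}}(t) > … > ψ_{α_{v (n-1)}}(t)`. -/
def IsOrderVec {n : ℕ} (α : Fin n → ℝ) (t : ℝ) (v : Fin n → Fin n) : Prop :=
  Function.Bijective v ∧
    ∀ p q : Fin n, p < q → psi (α (v p)) t > psi (α (v q)) t

/-- The order vector `v` occurs at arbitrarily large times. -/
def OccursInfinitely {n : ℕ} (α : Fin n → ℝ) (v : Fin n → Fin n) : Prop :=
  ∀ T : ℝ, ∃ t : ℝ, T < t ∧ IsOrderVec α t v

/-- `k(α)`: the number of distinct order vectors occurring for arbitrarily large `t`. -/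
noncomputable def kAlpha {n : ℕ} (α : Fin n → ℝ) : ℕ :=
  Nat.card {v : Fin n → Fin n | OccursInfinitely α v}

/-- The relative order of the functions `ψ_{α_i}` is the same at times `t` and `t'`
(i.e. the order vectors coincide). -/
def SameOrder {n : ℕ} (α : Fin n → ℝ) (t t' : ℝ) : Prop :=
  ∀ i j : Fin n, (psi (α i) t < psi (α j) t ↔ psi (α i) t' < psi (α j) t')

/-- `ts` is a sequence of moments of permutation changes:
`ts (i+1) = min { t > ts i : v_α(t) ≠ v_α(ts i) }`. -/
def IsChangeSeq {n : ℕ} (α : Fin n → ℝ) (ts : ℕ → ℝ) : Prop :=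
  ∀ i : ℕ, IsLeast {t : ℝ | ts i < t ∧ ¬ SameOrder α (ts i) t} (ts (i + 1))

/-- The set of positions `(j,l)`, `1 ≤ j ≤ l ≤ k` (here `0`-based). -/
def PairIdx (k : ℕ) := {p : Fin k × Fin k // p.1 ≤ p.2}

/-- Construct a position from `0`-based indices `j ≤ l < k`. -/
def mkPos {k : ℕ} (j l : ℕ) (hj : j ≤ l) (hl : l < k) : PairIdx k :=
  ⟨(⟨j, lt_of_le_of_lt hj hl⟩, ⟨l, hl⟩), Fin.mk_le_mk.mpr hj⟩

/-- The position permutation underlying `π`: one has `π(u) = u ∘ tau`.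
In `1`-based notation: `tau (i,i) = (i+1,i+1)` for `i < k`, `tau (k,k) = (1,1)`,
`tau (i,k) = (1,i+1)` for `i < k`, and `tau (i,j) = (i+1,j+1)` otherwise. -/
def tau {k : ℕ} (p : PairIdx k) : PairIdx k :=
  if h2 : p.1.2.val = k - 1 then
    if h1 : p.1.1.val = k - 1 then
      ⟨(⟨0, by have := p.1.2.isLt; omega⟩, ⟨0, by have := p.1.2.isLt; omega⟩), le_refl _⟩
    else
      ⟨(⟨0, by have := p.1.2.isLt; omega⟩,
        ⟨p.1.1.val + 1, by have := p.1.1.isLt; omega⟩),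
       Fin.mk_le_mk.mpr (by omega)⟩
  else
    ⟨(⟨p.1.1.val + 1, by have h := p.1.2.isLt; have h' : p.1.1.val ≤ p.1.2.val := p.2; omega⟩,
      ⟨p.1.2.val + 1, by have h := p.1.2.isLt; omega⟩),
     Fin.mk_le_mk.mpr (by have h' : p.1.1.val ≤ p.1.2.val := p.2; omega)⟩

/-- The action of `π` on vectors indexed by positions: `π(u) = u ∘ tau`. -/
def piMap {k : ℕ} {X : Type*} (u : PairIdx k → X) : PairIdx k → X :=
  fun p => u (tau p)

/-- The (`0`-based) linear position of the pair `(j,l)` in the special enumeration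
`u_{1,1}, u_{1,k}, u_{1,k-1}, …, u_{1,2}, u_{2,2}, u_{2,k}, …, u_{k,k}`. -/
def posIdx {k : ℕ} (p : PairIdx k) : ℕ :=
  (p.1.1.val * k - p.1.1.val * (p.1.1.val - 1) / 2) +
    (if p.1.2.val = p.1.1.val then 0 else k - p.1.2.val)

/-- `v : PairIdx k → Fin n` is the order vector of `α` at time `t`, written in the
special pair enumeration: the function at position `p` is larger than the one at
position `q` whenever `p` precedes `q` in the enumeration. -/
def IsOrderVecP {n k : ℕ} (α : Fin n → ℝ) (t : ℝ) (v : PairIdx k → Fin n) : Prop :=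
  Function.Bijective v ∧
    ∀ p q : PairIdx k, posIdx p < posIdx q → psi (α (v p)) t > psi (α (v q)) t

/-- Denominator `q_m` of the `m`-th convergent of the continued fraction of `α`. -/
noncomputable def cfDen (α : ℝ) (m : ℕ) : ℝ := (GenContFract.of α).dens m

/-- The orbit equivalence relation of the map `tau` on positions. -/
def orbitSetoid (k : ℕ) : Setoid (PairIdx k) where
  r p q := ∃ a b : ℕ, (fun x : PairIdx k => tau x)^[a] p = (fun x : PairIdx k => tau x)^[b] q
  iseqv := by
    constructor
    · exact fun p => ⟨0, 0, rfl⟩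
    · rintro p q ⟨a, b, h⟩; exact ⟨b, a, h.symm⟩
    · rintro p q r ⟨a, b, h1⟩ ⟨c, d, h2⟩
      refine ⟨c + a, b + d, ?_⟩
      rw [Function.iterate_add_apply, h1, ← Function.iterate_add_apply,
        Nat.add_comm c b, Function.iterate_add_apply, h2, ← Function.iterate_add_apply]

/-- The irrationality measure function at integer times. -/
noncomputable def psiN (α : ℝ) (m : ℕ) : ℝ := psi α m

/-- The signed distance of `qα` to its nearest integer. -/
noncomputable def approxErr (α : ℝ) (q : ℕ) : ℝ := (q : ℝ) * α - round ((q : ℝ) * α)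

/-- `q` is the denominator of a best approximation: the measure function drops at `q`. -/
def IsDen (α : ℝ) (q : ℕ) : Prop := 1 ≤ q ∧ ∀ p, 1 ≤ p → p < q → psiN α q < psiN α p

/-- `r < s` are consecutive denominators of best approximations. -/
def ConsDen (α : ℝ) (r s : ℕ) : Prop :=
  IsDen α r ∧ IsDen α s ∧ r < s ∧ ∀ m, r ≤ m → m < s → psiN α m = psiN α r

theorem psi_set_finite (α t : ℝ) :
    ((fun q : ℤ => distToInt ((q : ℝ) * α)) '' {q : ℤ | 1 ≤ q ∧ (q : ℝ) ≤ t}).Finite := by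
  apply Set.Finite.image
  refine (Set.finite_Icc (1 : ℤ) ⌊t⌋).subset ?_
  rintro q ⟨h1, h2⟩
  exact ⟨h1, Int.le_floor.2 h2⟩

theorem psi_eq_floor (α : ℝ) {t : ℝ} (ht : 0 ≤ t) : psi α t = psiN α ⌊t⌋₊ := by
  unfold psiN psi
  congr 2
  ext q
  simp only [Set.mem_ofPred_eq]
  refine and_congr_right fun h => ?_
  rw [← Int.le_floor, ← Int.natCast_floor_eq_floor ht]
  norm_cast

theorem psiN_le (α : ℝ) {q m : ℕ} (h1 : 1 ≤ q) (h2 : q ≤ m) : psiN α m ≤ |approxErr α q| := by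
  unfold psiN psi
  apply csInf_le (psi_set_finite α m).bddBelow
  exact ⟨(q : ℤ), ⟨by exact_mod_cast h1, by exact_mod_cast h2⟩, by simp [distToInt, approxErr]⟩

theorem psiN_attained (α : ℝ) {m : ℕ} (h1 : 1 ≤ m) :
    ∃ q, 1 ≤ q ∧ q ≤ m ∧ psiN α m = |approxErr α q| := by
  have hne : ((fun q : ℤ => distToInt ((q : ℝ) * α)) ''
      {q : ℤ | 1 ≤ q ∧ (q : ℝ) ≤ (m : ℝ)}).Nonempty :=
    ⟨_, 1, ⟨le_refl _, by exact_mod_cast h1⟩, rfl⟩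
  obtain ⟨q, ⟨hq1, hq2⟩, hq⟩ := hne.csInf_mem (psi_set_finite α m)
  lift q to ℕ using by omega
  exact ⟨q, by exact_mod_cast hq1, by exact_mod_cast hq2, by
    unfold psiN psi; rw [← hq]; simp [distToInt, approxErr]⟩

theorem psiN_anti (α : ℝ) {m m' : ℕ} (h1 : 1 ≤ m) (h : m ≤ m') : psiN α m' ≤ psiN α m := by
  obtain ⟨q, hq1, hq2, hq⟩ := psiN_attained α h1
  rw [hq]
  exact psiN_le α hq1 (hq2.trans h)

theorem approxErr_ne {α : ℝ} (hα : Irrational α) {q : ℕ} (h : 1 ≤ q) : approxErr α q ≠ 0 := by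
  unfold approxErr
  have h1 := (hα.natCast_mul (m := q) (by omega)).ne_int (round ((q : ℝ) * α))
  exact sub_ne_zero.2 h1

theorem psiN_pos {α : ℝ} (hα : Irrational α) {m : ℕ} (h : 1 ≤ m) : 0 < psiN α m := by
  obtain ⟨q, hq1, hq2, hq⟩ := psiN_attained α h
  rw [hq]
  exact abs_pos.2 (approxErr_ne hα hq1)

theorem psiN_dirichlet (α : ℝ) {m : ℕ} (h : 1 ≤ m) : psiN α m * (m + 1) ≤ 1 := by
  obtain ⟨j, q, hq, hqm, hle⟩ := Real.exists_int_int_abs_mul_sub_le α (n := m) (by omega)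
  lift q to ℕ using hq.le
  have h1 := psiN_le α (q := q) (m := m) (by exact_mod_cast hq) (by exact_mod_cast hqm)
  have h2 : |approxErr α q| ≤ 1 / (m + 1) :=
    (round_le ((q : ℝ) * α) j).trans (by simpa using hle)
  rw [← le_div_iff₀ (by positivity)]
  exact h1.trans h2

theorem IsDen.value {α : ℝ} {q : ℕ} (h : IsDen α q) : psiN α q = |approxErr α q| := by
  obtain ⟨p, hp1, hp2, hp⟩ := psiN_attained α h.1
  rcases hp2.eq_or_lt with rfl | hlt
  · exact hp
  · have := h.2 p hp1 hlt
    have := psiN_le α hp1 (le_refl p)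
    linarith

theorem exists_lastDen (α : ℝ) {m : ℕ} (h : 1 ≤ m) :
    ∃ r, r ≤ m ∧ IsDen α r ∧ psiN α r = psiN α m := by
  classical
  have hex : ∃ r, 1 ≤ r ∧ psiN α r = psiN α m := ⟨m, h, rfl⟩
  have hs := Nat.find_spec hex
  refine ⟨Nat.find hex, Nat.find_min' hex ⟨h, rfl⟩, ⟨hs.1, fun p hp1 hp2 => ?_⟩, hs.2⟩
  refine lt_of_le_of_ne (psiN_anti α hp1 hp2.le) fun heq => ?_
  exact Nat.find_min hex hp2 ⟨hp1, by rw [← heq]; exact hs.2⟩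

theorem isDen_of_jump {α : ℝ} {s : ℕ} (hs : 1 ≤ s) (h : psiN α (s + 1) < psiN α s) :
    IsDen α (s + 1) :=
  ⟨by omega, fun p h1 h2 => h.trans_le (psiN_anti α h1 (by omega))⟩

theorem exists_succDen_le {α : ℝ} {r s : ℕ} (hr : IsDen α r) (hs : IsDen α s) (h : r < s) :
    ∃ x, ConsDen α r x ∧ x ≤ s := by
  classical
  have hex : ∃ x, IsDen α x ∧ r < x := ⟨s, hs, h⟩
  have hsp := Nat.find_spec hex
  refine ⟨Nat.find hex, ⟨hr, hsp.1, hsp.2, fun m h1 h2 => ?_⟩, Nat.find_min' hex ⟨hs, h⟩⟩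
  have hr1 := hr.1
  obtain ⟨y, hy1, hy2, hy3⟩ := exists_lastDen α (m := m) (by omega)
  have hyr : y ≤ r := by
    by_contra hc
    exact Nat.find_min hex (lt_of_le_of_lt hy1 h2) ⟨hy2, by omega⟩
  have a1 := psiN_anti α hr1 h1
  have a2 := psiN_anti α hy2.1 hyr
  linarith

theorem exists_predDen {α : ℝ} {s : ℕ} (hs : IsDen α s) (h : 2 ≤ s) :
    ∃ r, ConsDen α r s := by
  obtain ⟨r, h1, h2, h3⟩ := exists_lastDen α (m := s - 1) (by omega)
  refine ⟨r, h2, hs, by omega, fun m hm1 hm2 => ?_⟩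
  have a1 := psiN_anti α h2.1 hm1
  have a2 := psiN_anti α (m := m) (m' := s - 1) (by have := h2.1; omega) (by omega)
  linarith

theorem exists_den_gt {α : ℝ} (hα : Irrational α) (m : ℕ) : ∃ s, IsDen α s ∧ m < s := by
  by_contra hc
  push Not at hc
  obtain ⟨N, hN⟩ := exists_nat_gt (1 / psiN α (m + 1))
  have hp := psiN_pos hα (m := m + 1) (by omega)
  have hd := psiN_dirichlet α (m := m + 1 + N) (by omega)
  obtain ⟨y, hy1, hy2, hy3⟩ := exists_lastDen α (m := m + 1 + N) (by omega)
  have hy4 := hc y hy2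
  have := hy2.1
  have a1 := psiN_anti α (m := y) (m' := m + 1) (by omega) (by omega)
  have a2 := psiN_anti α (m := m + 1) (m' := m + 1 + N) (by omega) (by omega)
  rw [div_lt_iff₀ hp] at hN
  have : psiN α (m + 1 + N) = psiN α (m + 1) := by linarith
  rw [this] at hd
  push_cast at hd
  nlinarith

theorem exists_succDen {α : ℝ} (hα : Irrational α) {r : ℕ} (hr : IsDen α r) :
    ∃ s, ConsDen α r s := by
  obtain ⟨s, hs, h⟩ := exists_den_gt hα r
  obtain ⟨x, hx, -⟩ := exists_succDen_le hr hs h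
  exact ⟨x, hx⟩

theorem ConsDen.lt_left {α : ℝ} {r s : ℕ} (h : ConsDen α r s) : psiN α s < psiN α r :=
  h.2.1.2 r h.1.1 h.2.2.1

theorem ConsDen.succ_unique {α : ℝ} {r s s' : ℕ} (h : ConsDen α r s) (h' : ConsDen α r s') :
    s = s' := by
  have h1 := h.1.1
  have a := h.2.2.1
  have b := h'.2.2.1
  rcases lt_trichotomy s s' with hlt | heq | hlt
  · have := h'.2.2.2 s a.le hlt
    have := h.lt_left
    linarith
  · exact heq
  · have := h.2.2.2 s' b.le hlt
    have := h'.lt_left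
    linarith

/-- The integer determinant of two approximations. -/
theorem approxErr_det (α : ℝ) (p q : ℕ) :
    (q : ℝ) * approxErr α p - p * approxErr α q =
      ((p * round ((q : ℝ) * α) - q * round ((p : ℝ) * α) : ℤ) : ℝ) := by
  unfold approxErr
  push_cast
  ring

theorem one_le_det {α : ℝ} (hα : Irrational α) {p q : ℕ} (hp : IsDen α p) (hq : IsDen α q)
    (h : p < q) : 1 ≤ (q : ℝ) * psiN α p + p * psiN α q := by
  have hdet := approxErr_det α p q
  set D : ℤ := p * round ((q : ℝ) * α) - q * round ((p : ℝ) * α) with hD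
  have h1 := hp.value
  have h2 := hq.value
  have hlt := hq.2 p hp.1 h
  have hpos := psiN_pos hα hq.1
  have hp1 : (1 : ℝ) ≤ p := by exact_mod_cast hp.1
  have hpq : (p : ℝ) < q := by exact_mod_cast h
  have hne : D ≠ 0 := by
    intro h0
    rw [h0] at hdet
    have : (q : ℝ) * approxErr α p = p * approxErr α q := by push_cast at hdet; linarith
    have h3 := congrArg abs this
    rw [abs_mul, abs_mul, ← h1, ← h2, Nat.abs_cast, Nat.abs_cast] at h3
    nlinarith
  have hD1 : (1 : ℝ) ≤ |(D : ℝ)| := by exact_mod_cast Int.one_le_abs hne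
  rw [← hdet] at hD1
  refine hD1.trans ((abs_sub _ _).trans ?_)
  rw [abs_mul, abs_mul, ← h1, ← h2, Nat.abs_cast, Nat.abs_cast]

theorem ConsDen.det {α : ℝ} (hα : Irrational α) {r s : ℕ} (h : ConsDen α r s) :
    (s : ℝ) * psiN α r + r * psiN α s = 1 ∧
      ((approxErr α r = psiN α r ∧ approxErr α s = - psiN α s) ∨
       (approxErr α r = - psiN α r ∧ approxErr α s = psiN α s)) := by
  obtain ⟨hr, hs, hrs, hc⟩ := h
  have hge := one_le_det hα hr hs hrs
  have hdet := approxErr_det α r s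
  set D : ℤ := r * round ((s : ℝ) * α) - s * round ((r : ℝ) * α) with hD
  have h1 := hr.value
  have h2 := hs.value
  have hlt := hs.2 r hr.1 hrs
  have hpos := psiN_pos hα hs.1
  have hr1 : (1 : ℝ) ≤ r := by exact_mod_cast hr.1
  have hrs' : (r : ℝ) < s := by exact_mod_cast hrs
  have hdir : (s : ℝ) * psiN α r ≤ 1 := by
    have h3 := psiN_dirichlet α (m := s - 1) (by have := hr.1; omega)
    rw [hc (s - 1) (by omega) (by omega)] at h3
    have h4 : ((s - 1 : ℕ) : ℝ) + 1 = s := by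
      have : s - 1 + 1 = s := by omega
      exact_mod_cast this
    rw [h4] at h3
    linarith
  have hb : (r : ℝ) * psiN α s < 1 := by nlinarith
  have hb0 : 0 < (r : ℝ) * psiN α s := by positivity
  have hbc : (r : ℝ) * psiN α s < s * psiN α r := by nlinarith
  rcases abs_cases (approxErr α r) with ⟨e1, e1'⟩ | ⟨e1, e1'⟩ <;>
  rcases abs_cases (approxErr α s) with ⟨e2, e2'⟩ | ⟨e2, e2'⟩
  · exfalso
    rw [e1] at h1
    rw [e2] at h2
    rw [← h1, ← h2] at hdet
    have a1 : (0 : ℝ) < D := by linarith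
    have a2 : (D : ℝ) < 1 := by linarith
    have a1' : 0 < D := by exact_mod_cast a1
    have a2' : D < 1 := by exact_mod_cast a2
    omega
  · have e1 : approxErr α r = psiN α r := by linarith
    have e2 : approxErr α s = - psiN α s := by linarith
    refine ⟨?_, Or.inl ⟨e1, e2⟩⟩
    rw [e1, e2] at hdet
    have a1 : (0 : ℝ) < D := by linarith
    have a2 : (D : ℝ) < 2 := by linarith
    have a1' : 0 < D := by exact_mod_cast a1
    have a2' : D < 2 := by exact_mod_cast a2
    have : D = 1 := by omega
    rw [this] at hdet
    push_cast at hdet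
    linarith
  · have e1 : approxErr α r = - psiN α r := by linarith
    have e2 : approxErr α s = psiN α s := by linarith
    refine ⟨?_, Or.inr ⟨e1, e2⟩⟩
    rw [e1, e2] at hdet
    have a1 : (D : ℝ) < 0 := by linarith
    have a2 : (-2 : ℝ) < D := by linarith
    have a1' : D < 0 := by exact_mod_cast a1
    have a2' : -2 < D := by exact_mod_cast a2
    have : D = -1 := by omega
    rw [this] at hdet
    push_cast at hdet
    linarith
  · exfalso
    have e1 : approxErr α r = - psiN α r := by linarith
    have e2 : approxErr α s = - psiN α s := by linarith
    rw [e1, e2] at hdet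
    have a1 : (D : ℝ) < 0 := by linarith
    have a2 : (-1 : ℝ) < D := by linarith
    have a1' : D < 0 := by exact_mod_cast a1
    have a2' : -1 < D := by exact_mod_cast a2
    omega

/-- Normalised sign of a consecutive pair. -/
theorem ConsDen.sign {α : ℝ} (hα : Irrational α) {r s : ℕ} (h : ConsDen α r s) :
    ∃ ε : ℤ, (ε = 1 ∨ ε = -1) ∧ approxErr α r = ε * psiN α r ∧
      approxErr α s = - (ε * psiN α s) ∧
      (r : ℤ) * round ((s : ℝ) * α) - s * round ((r : ℝ) * α) = ε := by
  obtain ⟨h1, h2⟩ := h.det hα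
  have hdet := approxErr_det α r s
  rcases h2 with ⟨a, b⟩ | ⟨a, b⟩
  · refine ⟨1, Or.inl rfl, by simp [a], by simp [b], ?_⟩
    rw [a, b] at hdet
    have : (1 : ℝ) = _ := (by linarith : (1 : ℝ) = s * psiN α r - r * -psiN α s).trans hdet
    exact_mod_cast this.symm
  · refine ⟨-1, Or.inr rfl, by simp [a], by simp [b], ?_⟩
    rw [a, b] at hdet
    have : (-1 : ℝ) = _ := (by linarith : (-1 : ℝ) = s * -psiN α r - r * psiN α s).trans hdet
    exact_mod_cast this.symm

theorem ConsDen.coprime {α : ℝ} (hα : Irrational α) {r s : ℕ} (h : ConsDen α r s) :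
    Nat.Coprime r s := by
  obtain ⟨ε, hε, -, -, hd⟩ := h.sign hα
  rw [← Nat.isCoprime_iff_coprime]
  rcases hε with rfl | rfl
  · exact ⟨round ((s : ℝ) * α), - round ((r : ℝ) * α), by linarith⟩
  · exact ⟨-round ((s : ℝ) * α), round ((r : ℝ) * α), by linarith⟩

theorem ConsDen.recurrence {α : ℝ} (hα : Irrational α) {u r s : ℕ} (h : ConsDen α u r)
    (h' : ConsDen α r s) :
    ∃ c : ℕ, 1 ≤ c ∧ s = c * r + u ∧ psiN α u = c * psiN α r + psiN α s := by
  obtain ⟨ε, hε, a1, a2, a3⟩ := h.sign hα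
  obtain ⟨η, hη, b1, b2, b3⟩ := h'.sign hα
  have d1 := (h.det hα).1
  have d2 := (h'.det hα).1
  have hr1 : (1 : ℝ) ≤ r := by exact_mod_cast h'.1.1
  have hpos := psiN_pos hα h'.1.1
  have hηε : η = -ε := by
    rw [a2] at b1
    have h0 : ((η : ℝ) + ε) * psiN α r = 0 := by linarith
    rcases mul_eq_zero.1 h0 with h0 | h0
    · have : η + ε = 0 := by exact_mod_cast h0
      omega
    · linarith
  have hdvd : (r : ℤ) ∣ ((s : ℤ) - u) * round ((r : ℝ) * α) :=
    ⟨round ((s : ℝ) * α) + round ((u : ℝ) * α) - 2 * round ((u : ℝ) * α), by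
      rw [hηε] at b3
      linarith⟩
  have hcop : IsCoprime (r : ℤ) (round ((r : ℝ) * α)) := by
    rcases hη with h0 | h0 <;> rw [h0] at b3
    · exact ⟨round ((s : ℝ) * α), - s, by linarith⟩
    · exact ⟨-round ((s : ℝ) * α), s, by linarith⟩
  have hus : u < s := h.2.2.1.trans h'.2.2.1
  obtain ⟨c, hc⟩ := hcop.dvd_of_dvd_mul_right hdvd
  have hru : u < r := h.2.2.1
  have hrs : r < s := h'.2.2.1
  have hcpos : 0 < c := by
    have : (0 : ℤ) < r * c := by rw [← hc]; omega
    exact pos_of_mul_pos_right this (by omega)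
  lift c to ℕ using hcpos.le
  have hs : s = c * r + u := by
    have : (s : ℤ) = c * r + u := by linarith
    exact_mod_cast this
  refine ⟨c, by omega, hs, ?_⟩
  have hs' : (s : ℝ) = c * r + u := by exact_mod_cast hs
  rw [hs'] at d2
  have : (r : ℝ) * psiN α u = r * (c * psiN α r + psiN α s) := by linarith
  exact mul_left_cancel₀ (by positivity) this

theorem ConsDen.mul_eq {α : ℝ} (hα : Irrational α) {u r s : ℕ} (h : ConsDen α u r)
    (h' : ConsDen α r s) :
    ∃ c : ℕ, 1 ≤ c ∧ s = c * r + u ∧ (s : ℝ) * psiN α u = c + u * psiN α s := by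
  obtain ⟨c, hc, hs, he⟩ := h.recurrence hα h'
  refine ⟨c, hc, hs, ?_⟩
  have hd := (h.det hα).1
  have hs' : (s : ℝ) = c * r + u := by exact_mod_cast hs
  have : psiN α s = psiN α u - c * psiN α r := by linarith
  rw [hs', this]
  linear_combination (c : ℝ) * hd

theorem ConsDen.mul_lt_one {α : ℝ} (hα : Irrational α) {r s : ℕ} (h : ConsDen α r s) :
    (s : ℝ) * psiN α r < 1 := by
  have h1 := (h.det hα).1
  have h2 := psiN_pos hα h.2.1.1
  have h3 : (1 : ℝ) ≤ r := by exact_mod_cast h.1.1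
  nlinarith

theorem not_isDen_of_lt {α β : ℝ} (hα : Irrational α) (hβ : Irrational β) {u w : ℕ}
    (h : ConsDen β u w) (hu : psiN α u < psiN β u) (hw : psiN α w < psiN β w) {p : ℕ}
    (hup : u < p) (hpw : p ≤ w) : ¬ IsDen α p := by
  intro hp
  have hu1 := h.1.1
  obtain ⟨a, ha1, ha2, ha3⟩ := exists_lastDen α hu1
  obtain ⟨b, hb1, hb2, hb3⟩ := exists_lastDen α h.2.1.1
  have hub : u < b := by
    by_contra hc
    have h1 := hp.2 b hb2.1 (by omega)
    have h2 := psiN_anti α hp.1 hpw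
    linarith
  have h1 := one_le_det hα ha2 hb2 (by omega)
  have h2 := (h.det hβ).1
  have p1 := psiN_pos hα hu1
  have p2 := psiN_pos hα h.2.1.1
  rw [ha3, hb3] at h1
  have c1 : (b : ℝ) ≤ w := by exact_mod_cast hb1
  have c2 : (a : ℝ) ≤ u := by exact_mod_cast ha1
  have c3 : (1 : ℝ) ≤ u := by exact_mod_cast hu1
  have c4 : (u : ℝ) < w := by exact_mod_cast h.2.2.1
  nlinarith

theorem lt_of_consDen {α β : ℝ} (hα : Irrational α) (hβ : Irrational β) {y u r s : ℕ}
    (hy : ConsDen α y s) (hu : ConsDen β u r) (hr : ConsDen β r s) :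
    psiN α y < psiN β u := by
  have h1 := hy.mul_lt_one hα
  obtain ⟨c, hc, -, h2⟩ := hu.mul_eq hβ hr
  have h3 := psiN_pos hβ hr.2.1.1
  have hc' : (1 : ℝ) ≤ c := by exact_mod_cast hc
  have hs : (1 : ℝ) ≤ s := by exact_mod_cast hr.2.1.1
  have hu0 : (1 : ℝ) ≤ u := by exact_mod_cast hu.1.1
  by_contra hcon
  push Not at hcon
  have : (s : ℝ) * psiN β u ≤ s * psiN α y := by gcongr
  nlinarith

theorem lt_of_consDen_of_mem {α β : ℝ} (hα : Irrational α) (hβ : Irrational β) {y u r s m : ℕ}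
    (hy : ConsDen α y s) (hu : ConsDen β u r) (hr : ConsDen β r s) (h1 : y ≤ m) (h2 : m < r) :
    psiN α m < psiN β m := by
  have h3 := lt_of_consDen hα hβ hy hu hr
  have hy1 := hy.1.1
  rw [hy.2.2.2 m h1 (h2.trans hr.2.2.1)]
  have h4 := psiN_anti β (m := m) (m' := r - 1) (by omega) (by omega)
  have h5 := hu.2.2.2 (r - 1) (by have := hu.2.2.1; omega) (by have := hu.2.2.1; omega)
  linarith

theorem le_pred_of_lt {α β : ℝ} (hα : Irrational α) (hβ : Irrational β) {u r s : ℕ}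
    (hu : ConsDen β u r) (hr : ConsDen β r s) (hs : IsDen α s) (hlt : psiN α s < psiN β s) :
    psiN α (r - 1) ≤ psiN β (r - 1) := by
  by_contra hcon
  push Not at hcon
  have hur := hu.2.2.1
  have hrs := hr.2.2.1
  have hu1 := hu.1.1
  rw [hu.2.2.2 (r - 1) (by omega) (by omega)] at hcon
  obtain ⟨x, hx1, hx2, hx3⟩ := exists_lastDen α (m := r - 1) (by omega)
  rw [← hx3] at hcon
  obtain ⟨x', hx', hxs⟩ := exists_succDen_le hx2 hs (by omega)
  have hrx : r ≤ x' := by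
    by_contra hc
    have := psiN_anti α hx'.2.1.1 (m' := r - 1) (by omega)
    have := hx'.lt_left
    linarith
  have hs1 : (1 : ℝ) ≤ s := by exact_mod_cast hs.1
  have hup : (1 : ℝ) ≤ u := by exact_mod_cast hu1
  have hxp : (1 : ℝ) ≤ x := by exact_mod_cast hx2.1
  rcases hxs.eq_or_lt with rfl | hxs
  · have := lt_of_consDen hα hβ hx' hu hr
    linarith
  obtain ⟨c, hc, hsc, hmul⟩ := hu.mul_eq hβ hr
  obtain ⟨ε, hε, e1, e2, e3⟩ := hx'.sign hα
  have hαs := hs.value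
  have hdir := psiN_dirichlet α hs.1
  have hps := psiN_pos hα hs.1
  have d1 := approxErr_det α x s
  have d2 := approxErr_det α x' s
  set P := round ((x : ℝ) * α) with hP
  set P' := round ((x' : ℝ) * α) with hP'
  set Q := round ((s : ℝ) * α) with hQ
  have hxs' : (x : ℝ) < s := by exact_mod_cast (hx'.2.2.1.trans hxs)
  have hx's' : (x' : ℝ) < s := by exact_mod_cast hxs
  have hx'p : (1 : ℝ) ≤ x' := by exact_mod_cast hx'.2.1.1
  have l1 := hs.2 x' hx'.2.1.1 hxs
  have l2 := hx'.lt_left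
  have habs : |approxErr α s| ≤ psiN α s := hαs.symm.le
  obtain ⟨g1, g2⟩ := abs_le.1 habs
  set A : ℤ := ε * (x * Q - s * P) with hA
  set B : ℤ := ε * (s * P' - x' * Q) with hB
  have hεε : ε * ε = 1 := by rcases hε with h | h <;> rw [h] <;> norm_num
  have hAx : (s : ℤ) = A * x' + B * x := by
    rw [hA, hB]
    linear_combination (-(s : ℤ)) * hεε + (ε * s) * (-e3)
  have hεεR : (ε : ℝ) * ε = 1 := by exact_mod_cast hεε
  have hAR : (A : ℝ) = s * psiN α x - ε * (x * approxErr α s) := by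
    rw [hA]
    push_cast
    push_cast at d1
    rw [← d1, e1]
    linear_combination ((s : ℝ) * psiN α x) * hεεR
  have hBR : (B : ℝ) = s * psiN α x' + ε * (x' * approxErr α s) := by
    rw [hB]
    push_cast
    push_cast at d2
    have : (s : ℝ) * P' - x' * Q = -(s * approxErr α x' - x' * approxErr α s) := by
      rw [d2]; ring
    rw [this, e2]
    linear_combination ((s : ℝ) * psiN α x') * hεεR
  have hεb : ∀ z : ℝ, 0 ≤ z → -(z * psiN α s) ≤ ε * (z * approxErr α s) ∧
      ε * (z * approxErr α s) ≤ z * psiN α s := by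
    intro z hz
    have h0 := mul_le_mul_of_nonneg_left g1 hz
    have h1 := mul_le_mul_of_nonneg_left g2 hz
    rcases hε with h | h <;> rw [h] <;> push_cast <;> constructor <;> linarith
  have hApos : 0 < A := by
    have : (0 : ℝ) < A := by
      have h1 := (hεb x (by linarith)).2
      have h2 : (x : ℝ) * psiN α s < s * psiN α x :=
        mul_lt_mul'' hxs' (l1.trans l2) (by linarith) hps.le
      rw [hAR]
      linarith
    exact_mod_cast this
  have hBpos : 0 < B := by
    have : (0 : ℝ) < B := by
      have h1 := (hεb x' (by linarith)).1
      have h2 : (x' : ℝ) * psiN α s < s * psiN α x' :=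
        mul_lt_mul'' hx's' l1 (by linarith) hps.le
      rw [hBR]
      linarith
    exact_mod_cast this
  have hsx : (s : ℝ) * psiN α x ≤ A + x * psiN α s := by
    have := (hεb x (by linarith)).2
    linarith
  have hcon' : (s : ℝ) * psiN β u < s * psiN α x := by
    apply mul_lt_mul_of_pos_left hcon; linarith
  have hpβ := psiN_pos hβ hs.1
  have hAc : (c : ℤ) ≤ A := by
    have h1 : (x : ℝ) * psiN α s < s * psiN α s := mul_lt_mul_of_pos_right hxs' hps
    have h2 : 0 < (u : ℝ) * psiN β s := by positivity
    have : (c : ℝ) - 1 < A := by linarith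
    have : (c : ℤ) - 1 < A := by exact_mod_cast this
    omega
  have hu0 : (0 : ℤ) < u := by exact_mod_cast hu1
  have hx0 : (0 : ℤ) < x := by exact_mod_cast hx2.1
  have hsc' : (s : ℤ) = c * r + u := by exact_mod_cast hsc
  have hrx' : (r : ℤ) ≤ x' := by exact_mod_cast hrx
  have hur' : (u : ℤ) < r := by exact_mod_cast hur
  have hBx : (x : ℤ) ≤ B * x := by nlinarith
  have hr0 : (0 : ℤ) < r := by omega
  rcases hAc.eq_or_lt with hAc | hAc
  · have hxu : (x : ℤ) ≤ u := by
      have : (c : ℤ) * r ≤ A * x' := by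
        rw [← hAc]; exact mul_le_mul_of_nonneg_left hrx' (by omega)
      linarith
    have hxu' : (x : ℝ) ≤ u := by exact_mod_cast hxu
    have hcA : (A : ℝ) = c := by rw [← hAc]; simp
    rw [hcA] at hsx
    have h1 : (x : ℝ) * psiN α s ≤ u * psiN α s := mul_le_mul_of_nonneg_right hxu' hps.le
    have h2 : (u : ℝ) * psiN α s < u * psiN β s := mul_lt_mul_of_pos_left hlt (by linarith)
    linarith
  · have : ((c : ℤ) + 1) * r ≤ A * x' :=
      mul_le_mul (by omega) hrx' (by omega) (by omega)
    nlinarith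

theorem flip_at_pred {α β : ℝ} (hα : Irrational α) (hβ : Irrational β) {r s : ℕ}
    (hr2 : 2 ≤ r) (hr : ConsDen β r s) (hs : IsDen α s) (hlt : psiN α s < psiN β s)
    (h1 : psiN α (r - 1) ≠ psiN β (r - 1)) (h2 : psiN α r ≠ psiN β r) :
    psiN α (r - 1) < psiN β (r - 1) ∧ psiN β r < psiN α r := by
  obtain ⟨u, hu⟩ := exists_predDen hr.1 hr2
  refine ⟨lt_of_le_of_ne (le_pred_of_lt hα hβ hu hr hs hlt) h1, ?_⟩
  refine lt_of_le_of_ne ?_ h2.symm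
  by_contra hc
  push Not at hc
  exact not_isDen_of_lt hα hβ hr hc hlt hr.2.2.1 (le_refl _) hs

theorem abs_sub_of_consDen {α β : ℝ} (hα : Irrational α) (hβ : Irrational β) (s : ℕ) :
    ∀ r, ConsDen α r s → ConsDen β r s →
      |psiN α s - psiN β s| = s * |psiN α 1 - psiN β 1| := by
  induction s using Nat.strong_induction_on with
  | _ s ih =>
    intro r h h'
    have d1 := (h.det hα).1
    have d2 := (h'.det hβ).1
    have hr1 := h.1.1
    have hrr : (0 : ℝ) < r := by exact_mod_cast hr1
    have key : |psiN α s - psiN β s| * r = s * |psiN α r - psiN β r| := by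
      have : (psiN α s - psiN β s) * r = -(s * (psiN α r - psiN β r)) := by linarith
      have := congrArg abs this
      rwa [abs_neg, abs_mul, abs_mul, Nat.abs_cast, Nat.abs_cast] at this
    rcases hr1.eq_or_lt with rfl | hr2
    · simpa using key
    · obtain ⟨u, hu⟩ := exists_predDen h.1 hr2
      obtain ⟨u', hu'⟩ := exists_predDen h'.1 hr2
      obtain ⟨c, -, hc, -⟩ := hu.recurrence hα h
      obtain ⟨c', -, hc', -⟩ := hu'.recurrence hβ h'
      have hm : s % r = u := by
        rw [hc, mul_comm, Nat.mul_add_mod, Nat.mod_eq_of_lt hu.2.2.1]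
      have hm' : s % r = u' := by
        rw [hc', mul_comm, Nat.mul_add_mod, Nat.mod_eq_of_lt hu'.2.2.1]
      have huu : u = u' := hm.symm.trans hm'
      subst huu
      rw [ih r h.2.2.1 u hu hu'] at key
      have : |psiN α s - psiN β s| * r = (s * |psiN α 1 - psiN β 1|) * r := by
        rw [key]; ring
      exact mul_right_cancel₀ hrr.ne' this

theorem exists_not_common_pred {α β : ℝ} (hα : Irrational α) (hβ : Irrational β)
    (h : ∃ M, ∀ m, M ≤ m → psiN α m ≠ psiN β m) :
    ∃ M, ∀ s, M ≤ s → ∀ r, ¬ (ConsDen α r s ∧ ConsDen β r s) := by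
  obtain ⟨M, hM⟩ := h
  by_cases h0 : |psiN α 1 - psiN β 1| = 0
  · refine ⟨M, fun s hs r hr => hM s hs ?_⟩
    have := abs_sub_of_consDen hα hβ s r hr.1 hr.2
    rw [h0, mul_zero, abs_eq_zero] at this
    linarith
  · have hp : 0 < |psiN α 1 - psiN β 1| := lt_of_le_of_ne (abs_nonneg _) (Ne.symm h0)
    obtain ⟨N, hN⟩ := exists_nat_gt (1 / |psiN α 1 - psiN β 1|)
    refine ⟨N, fun s hs r hr => ?_⟩
    have h1 := abs_sub_of_consDen hα hβ s r hr.1 hr.2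
    rw [div_lt_iff₀ hp] at hN
    have h2 : (N : ℝ) ≤ s := by exact_mod_cast hs
    have s1 := hr.1.2.1.1
    have s1' : (1 : ℝ) ≤ s := by exact_mod_cast s1
    have a1 := psiN_pos hα s1
    have a2 := psiN_pos hβ s1
    have a3 := psiN_dirichlet α s1
    have a4 := psiN_dirichlet β s1
    have h3 : |psiN α s - psiN β s| ≤ 1 := by
      rw [abs_le]; constructor <;> nlinarith
    nlinarith

theorem not_eventually_lt {α β : ℝ} (hα : Irrational α) (hβ : Irrational β) (M : ℕ) :
    ∃ m, M ≤ m ∧ psiN β m ≤ psiN α m := by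
  by_contra hc
  push Not at hc
  obtain ⟨u, hu, hMu⟩ := exists_den_gt hβ M
  obtain ⟨p, hp, hup⟩ := exists_den_gt hα u
  obtain ⟨v, hv1, hv2, hv3⟩ := exists_lastDen β (m := p - 1) (by omega)
  have huv : u ≤ v := by
    by_contra hcon
    have h1 := hu.2 v hv2.1 (by omega)
    have h2 := psiN_anti β hu.1 (m' := p - 1) (by omega)
    linarith
  obtain ⟨w, hw⟩ := exists_succDen hβ hv2
  have hwp : p ≤ w := by
    by_contra hcon
    have h1 := psiN_anti β hw.2.1.1 (m' := p - 1) (by omega)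
    have := hw.lt_left
    linarith
  have hvw := hw.2.2.1
  exact not_isDen_of_lt hα hβ hw (hc v (by omega)) (hc w (by omega)) (by omega) hwp hp

theorem exists_pred_ge {α : ℝ} (hα : Irrational α) (N : ℕ) :
    ∃ M, ∀ s, M ≤ s → ∀ r, ConsDen α r s → N ≤ r := by
  obtain ⟨a, ha, hNa⟩ := exists_den_gt hα N
  refine ⟨a + 1, fun s hs r hr => ?_⟩
  by_contra hcon
  have h1 := ha.2 r hr.1.1 (by omega)
  have h2 := hr.2.2.2 a (by omega) (by omega)
  linarith

/-- A finite system of strict linear orders on `ι` (a pair `(i, j)` of a pattern means that `i` is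
below `j`), with a strongly connected transition relation, such that a set of elements going down
simultaneously cannot be larger than the number of orders induced on it. -/
structure PatSys (ι : Type*) [DecidableEq ι] where
  R : Finset (Finset (ι × ι))
  E : Finset (ι × ι) → Finset (ι × ι) → Prop
  memLeft : ∀ v w, E v w → v ∈ R
  memRight : ∀ v w, E v w → w ∈ R
  irr : ∀ v ∈ R, ∀ i, (i, i) ∉ v
  total : ∀ v ∈ R, ∀ i j, i ≠ j → ((i, j) ∈ v ↔ (j, i) ∉ v)
  nonempty : R.Nonempty
  connected : ∀ A : Finset (ι × ι) → Prop, (∃ v ∈ R, A v) → (∃ v ∈ R, ¬ A v) →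
    ∃ v w, E v w ∧ A v ∧ ¬ A w
  flips : ∀ i j, i ≠ j → ∃ v ∈ R, (i, j) ∈ v
  descent : ∀ v w, E v w → ∀ J : Finset ι, (∀ i ∈ J, ∃ j, (j, i) ∈ v ∧ (i, j) ∈ w) →
    J.card ≤ (R.image fun x => x ∩ (J ×ˢ J)).card

namespace PatSys

variable {ι : Type*} [DecidableEq ι]

/-- Restriction of a pattern to a subset. -/
def res (J : Finset ι) (v : Finset (ι × ι)) : Finset (ι × ι) := v ∩ (J ×ˢ J)

/-- The elements of `J` that go down past some element of `J` between `v` and `w`. -/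
def down (J : Finset ι) (v w : Finset (ι × ι)) : Finset ι :=
  J.filter fun i => ∃ j ∈ J, (j, i) ∈ v ∧ (i, j) ∈ w

theorem res_eq_iff (J : Finset ι) (v w : Finset (ι × ι)) :
    res J v = res J w ↔ ∀ a ∈ J, ∀ b ∈ J, (a, b) ∈ v ↔ (a, b) ∈ w := by
  constructor
  · intro h a ha b hb
    have := Finset.ext_iff.1 h (a, b)
    simp only [res, Finset.mem_inter, Finset.mem_product, ha, hb, and_self, and_true] at this
    exact this
  · intro h
    ext ⟨a, b⟩
    simp only [res, Finset.mem_inter, Finset.mem_product]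
    constructor
    · rintro ⟨h1, h2, h3⟩
      exact ⟨(h a h2 b h3).1 h1, h2, h3⟩
    · rintro ⟨h1, h2, h3⟩
      exact ⟨(h a h2 b h3).2 h1, h2, h3⟩

theorem res_res {J J' : Finset ι} (h : J' ⊆ J) (v : Finset (ι × ι)) :
    res J' (res J v) = res J' v := by
  rw [res_eq_iff]
  intro a ha b hb
  simp [res, h ha, h hb]

theorem res_univ [Fintype ι] (v : Finset (ι × ι)) : res Finset.univ v = v := by
  ext; simp [res]

variable (P : PatSys ι)

/-- The number of orders induced on `J`. -/
def count (J : Finset ι) : ℕ := (P.R.image (res J)).card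

theorem down_card_le {v w : Finset (ι × ι)} (h : P.E v w) (J : Finset ι) :
    (down J v w).card ≤ P.count (down J v w) := by
  refine P.descent v w h _ fun i hi => ?_
  obtain ⟨-, j, -, h2⟩ := Finset.mem_filter.1 hi
  exact ⟨j, h2⟩

theorem image_res {J J' : Finset ι} (h : J' ⊆ J) :
    (P.R.image (res J)).image (res J') = P.R.image (res J') := by
  rw [Finset.image_image]
  refine Finset.image_congr fun v _ => ?_
  exact res_res h v

theorem count_mono {J J' : Finset ι} (h : J' ⊆ J) : P.count J' ≤ P.count J := by
  unfold count
  rw [← P.image_res h]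
  exact Finset.card_image_le

theorem count_lt {J J' : Finset ι} (h : J' ⊆ J) {v w : Finset (ι × ι)} (hv : v ∈ P.R)
    (hw : w ∈ P.R) (h1 : res J v ≠ res J w) (h2 : res J' v = res J' w) :
    P.count J' + 1 ≤ P.count J := by
  refine lt_of_le_of_ne (P.count_mono h) fun heq => h1 ?_
  unfold count at heq
  rw [← P.image_res h, Finset.card_image_iff] at heq
  refine heq (Finset.mem_coe.2 (Finset.mem_image_of_mem _ hv))
    (Finset.mem_coe.2 (Finset.mem_image_of_mem _ hw)) ?_
  rw [res_res h, res_res h, h2]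

theorem inj_of_count_eq {J J' : Finset ι} (h : J' ⊆ J) (hc : P.count J' = P.count J)
    {v w : Finset (ι × ι)} (hv : v ∈ P.R)
    (hw : w ∈ P.R) (h1 : res J v ≠ res J w) : res J' v ≠ res J' w := by
  intro h2
  have := P.count_lt h hv hw h1 h2
  omega

theorem injOn_erase {J J' : Finset ι} (h : J' ⊆ J) {v w : Finset (ι × ι)} (hv : v ∈ P.R)
    (hw : w ∈ P.R) (h1 : res J v ≠ res J w) (h2 : res J' v = res J' w)
    (hc : P.count J' + 1 = P.count J) {x y : Finset (ι × ι)} (hx : x ∈ P.R) (hy : y ∈ P.R)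
    (hxw : res J x ≠ res J w) (hyw : res J y ≠ res J w) (hxy : res J' x = res J' y) :
    res J x = res J y := by
  have hwS : res J w ∈ P.R.image (res J) := Finset.mem_image_of_mem _ hw
  have himg : ((P.R.image (res J)).erase (res J w)).image (res J') = P.R.image (res J') := by
    rw [← P.image_res h]
    apply Finset.Subset.antisymm
    · exact Finset.image_subset_image (Finset.erase_subset _ _)
    · intro z hz
      obtain ⟨u, hu, rfl⟩ := Finset.mem_image.1 hz
      by_cases huw : u = res J w
      · refine Finset.mem_image.2 ⟨res J v, Finset.mem_erase.2
          ⟨h1, Finset.mem_image_of_mem _ hv⟩, ?_⟩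
        rw [huw, res_res h, res_res h, h2]
      · exact Finset.mem_image_of_mem _ (Finset.mem_erase.2 ⟨huw, hu⟩)
  have hcard := Finset.card_erase_of_mem hwS
  have hinj : Set.InjOn (res J') ((P.R.image (res J)).erase (res J w) : Finset _) := by
    rw [← Finset.card_image_iff, himg, hcard]
    unfold count at hc
    omega
  refine hinj (Finset.mem_coe.2 (Finset.mem_erase.2 ⟨hxw, Finset.mem_image_of_mem _ hx⟩))
    (Finset.mem_coe.2 (Finset.mem_erase.2 ⟨hyw, Finset.mem_image_of_mem _ hy⟩)) ?_
  rw [res_res h, res_res h, hxy]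

theorem identified {J J' : Finset ι} (h : J' ⊆ J) {v w : Finset (ι × ι)} (hv : v ∈ P.R)
    (hw : w ∈ P.R) (h1 : res J v ≠ res J w) (h2 : res J' v = res J' w)
    (hc : P.count J' + 1 = P.count J) {x y : Finset (ι × ι)} (hx : x ∈ P.R) (hy : y ∈ P.R)
    (hne : res J x ≠ res J y) (hxy : res J' x = res J' y) :
    (res J x = res J v ∧ res J y = res J w) ∨ (res J x = res J w ∧ res J y = res J v) := by
  have a1 := fun hxw hyw => hne (P.injOn_erase h hv hw h1 h2 hc hx hy hxw hyw hxy)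
  have a2 := fun hxw hyw => hne (P.injOn_erase h hw hv h1.symm h2.symm hc hx hy hxw hyw hxy)
  by_cases b1 : res J x = res J w
  · by_cases b2 : res J y = res J v
    · exact Or.inr ⟨b1, b2⟩
    · exact absurd b2 fun b2 => a2 (by rw [b1]; exact h1.symm) b2
  · by_cases b2 : res J y = res J w
    · by_cases b3 : res J x = res J v
      · exact Or.inl ⟨b3, b2⟩
      · exact absurd b3 fun b3 => a2 b3 (by rw [b2]; exact h1.symm)
    · exact absurd b2 fun b2 => a1 b1 b2

theorem down_compl {v w : Finset (ι × ι)} (hv : v ∈ P.R) (hw : w ∈ P.R) (J : Finset ι) :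
    res (J \ down J v w) v = res (J \ down J v w) w := by
  rw [res_eq_iff]
  intro a ha b hb
  rw [Finset.mem_sdiff] at ha hb
  have key : ∀ i ∈ J, ∀ j ∈ J, (j, i) ∈ v → (i, j) ∈ w → i ∈ down J v w := fun i hi j hj h1 h2 =>
    Finset.mem_filter.2 ⟨hi, j, hj, h1, h2⟩
  constructor
  · intro h
    by_contra hc
    have hab : a ≠ b := fun he => P.irr v hv b (he ▸ h)
    exact hb.2 (key b hb.1 a ha.1 h ((P.total w hw b a hab.symm).2 hc))
  · intro h
    by_contra hc
    have hab : a ≠ b := fun he => P.irr w hw b (he ▸ h)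
    exact ha.2 (key a ha.1 b hb.1 ((P.total v hv b a hab.symm).2 hc) h)

theorem exists_edge_res {J : Finset ι} {x : Finset (ι × ι)} (hx : x ∈ P.R)
    (h : ∃ y ∈ P.R, res J y ≠ res J x) :
    ∃ v w, P.E v w ∧ res J v = res J x ∧ res J w ≠ res J x :=
  P.connected (fun z => res J z = res J x) ⟨x, hx, rfl⟩ h

theorem exists_edge_res' {J : Finset ι} {x : Finset (ι × ι)} (hx : x ∈ P.R)
    (h : ∃ y ∈ P.R, res J y ≠ res J x) :
    ∃ v w, P.E v w ∧ res J v ≠ res J x ∧ res J w = res J x := by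
  obtain ⟨v, w, h1, h2, h3⟩ := P.connected (fun z => res J z ≠ res J x) h ⟨x, hx, by simp⟩
  exact ⟨v, w, h1, h2, not_not.1 h3⟩

theorem exists_res_ne {J : Finset ι} {i j : ι} (hi : i ∈ J) (hj : j ∈ J) (hij : i ≠ j)
    (x : Finset (ι × ι)) : ∃ y ∈ P.R, res J y ≠ res J x := by
  by_cases h : (i, j) ∈ x
  · obtain ⟨y, hy, hy'⟩ := P.flips j i hij.symm
    refine ⟨y, hy, fun he => ?_⟩
    rw [res_eq_iff] at he
    exact (P.total y hy j i hij.symm).1 hy' ((he i hi j hj).2 h)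
  · obtain ⟨y, hy, hy'⟩ := P.flips i j hij
    refine ⟨y, hy, fun he => ?_⟩
    rw [res_eq_iff] at he
    exact h ((he i hi j hj).1 hy')

theorem count_pos (J : Finset ι) : 1 ≤ P.count J :=
  Finset.card_pos.2 (P.nonempty.image _)

theorem two_mul_card_le (J : Finset ι) : 2 * J.card ≤ P.count J * (P.count J + 1) := by
  induction hk : P.count J using Nat.strong_induction_on generalizing J with
  | _ K ih =>
    have hpos := P.count_pos J
    rw [hk] at hpos
    rcases Nat.lt_or_ge 1 J.card with hJ | hJ
    · obtain ⟨i, hi, j, hj, hij⟩ := Finset.one_lt_card.1 hJ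
      obtain ⟨x, hx⟩ := P.nonempty
      obtain ⟨v, w, hE, hvw1, hvw2⟩ := P.exists_edge_res hx (P.exists_res_ne hi hj hij x)
      have hv := P.memLeft v w hE
      have hw := P.memRight v w hE
      have hne : res J v ≠ res J w := fun h => hvw2 (h ▸ hvw1)
      have hsub : down J v w ⊆ J := Finset.filter_subset _ _
      have h1 := P.down_card_le hE J
      have h2 := P.count_mono hsub
      have h3 := P.count_lt Finset.sdiff_subset hv hw hne (P.down_compl hv hw J)
      have h4 := ih _ (by omega) (J \ down J v w) rfl
      have h5 := Finset.card_sdiff_add_card_eq_card hsub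
      set K' := P.count (J \ down J v w)
      have h6 : K' * (K' + 1) ≤ (K - 1) * (K - 1 + 1) := Nat.mul_le_mul (by omega) (by omega)
      obtain ⟨L, rfl⟩ : ∃ L, K = L + 1 := ⟨K - 1, by omega⟩
      simp only [Nat.add_sub_cancel] at h6
      nlinarith
    · have : 1 * (1 + 1) ≤ K * (K + 1) := Nat.mul_le_mul hpos (by omega)
      omega

/-- `J` is as large as the number of induced orders permits. -/
def Extremal (J : Finset ι) : Prop := 2 * J.card = P.count J * (P.count J + 1)

variable {P}

theorem Extremal.edge {J : Finset ι} (hJ : P.Extremal J) {v w : Finset (ι × ι)} (hE : P.E v w)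
    (hne : res J v ≠ res J w) :
    (down J v w).card = P.count J ∧ P.count (down J v w) = P.count J ∧
      P.count (J \ down J v w) + 1 = P.count J ∧ P.Extremal (J \ down J v w) := by
  unfold Extremal at hJ ⊢
  have hv := P.memLeft v w hE
  have hw := P.memRight v w hE
  have hsub : down J v w ⊆ J := Finset.filter_subset _ _
  have h1 := P.down_card_le hE J
  have h2 := P.count_mono hsub
  have h3 := P.count_lt Finset.sdiff_subset hv hw hne (P.down_compl hv hw J)
  have h4 := P.two_mul_card_le (J \ down J v w)
  have h5 := Finset.card_sdiff_add_card_eq_card hsub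
  set K' := P.count (J \ down J v w)
  set K := P.count J
  obtain ⟨L, hL⟩ : ∃ L, K = L + 1 := ⟨K - 1, by omega⟩
  have hKL : K' = L := by
    by_contra hc
    have h6 : K' * (K' + 1) ≤ K' * L := Nat.mul_le_mul (by omega) (by omega)
    have h7 : K' * L + L ≤ L * L := by
      have : (K' + 1) * L ≤ L * L := Nat.mul_le_mul (by omega) le_rfl
      nlinarith
    rw [hL] at hJ
    have : L ≥ 1 := by omega
    nlinarith
  rw [hKL] at h4
  rw [hL] at hJ
  have e1 : (down J v w).card = L + 1 := by nlinarith
  refine ⟨by omega, by omega, by omega, ?_⟩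
  rw [hKL]
  nlinarith

theorem Extremal.inter_card_le {J : Finset ι} (hJ : P.Extremal J) {v w v' w' : Finset (ι × ι)}
    (hE : P.E v w) (hE' : P.E v' w') (hne : res J v ≠ res J w) (hne' : res J v' ≠ res J w')
    (h1 : ¬ (res J v' = res J v ∧ res J w' = res J w))
    (h2 : ¬ (res J v' = res J w ∧ res J w' = res J v)) :
    (down J v w ∩ down J v' w').card ≤ 1 := by
  obtain ⟨a1, a2, a3, a4⟩ := hJ.edge hE hne
  obtain ⟨b1, -, -, -⟩ := hJ.edge hE' hne'
  have hv := P.memLeft v w hE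
  have hw := P.memRight v w hE
  have hne2 : res (J \ down J v w) v' ≠ res (J \ down J v w) w' := fun h =>
    (P.identified Finset.sdiff_subset hv hw hne (P.down_compl hv hw J) a3 (P.memLeft _ _ hE')
      (P.memRight _ _ hE') hne' h).elim h1 h2
  obtain ⟨c1, -, -, -⟩ := a4.edge hE' hne2
  have hsub : down (J \ down J v w) v' w' ⊆ down J v' w' \ down J v w := by
    intro i hi
    obtain ⟨d1, j, d2, d3⟩ := Finset.mem_filter.1 hi
    rw [Finset.mem_sdiff] at d1 d2 ⊢
    exact ⟨Finset.mem_filter.2 ⟨d1.1, j, d2.1, d3⟩, d1.2⟩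
  have e1 := Finset.card_le_card hsub
  have e2 := Finset.card_sdiff_add_card_inter (down J v' w') (down J v w)
  rw [Finset.inter_comm]
  omega

theorem res_mem_of_count {J : Finset ι} {x y z : Finset (ι × ι)} (hx : x ∈ P.R) (hy : y ∈ P.R)
    (hz : z ∈ P.R) (hxy : res J x ≠ res J y) (hxz : res J x ≠ res J z) (hyz : res J y ≠ res J z)
    (hc : P.count J = 3) {u : Finset (ι × ι)} (hu : u ∈ P.R) :
    res J u = res J x ∨ res J u = res J y ∨ res J u = res J z := by
  by_contra hcon
  push Not at hcon
  have hsub : ({res J u, res J x, res J y, res J z} : Finset _) ⊆ P.R.image (res J) := by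
    intro a ha
    simp only [Finset.mem_insert, Finset.mem_singleton] at ha
    rcases ha with rfl | rfl | rfl | rfl <;> exact Finset.mem_image_of_mem _ ‹_›
  have h1 := Finset.card_le_card hsub
  rw [Finset.card_insert_of_notMem (by simp [hcon]), Finset.card_insert_of_notMem
    (by simp [hxy, hxz]), Finset.card_insert_of_notMem (by simp [hyz]),
    Finset.card_singleton] at h1
  unfold count at hc
  omega

theorem Extremal.no_two_cycle {J : Finset ι} (hJ : P.Extremal J) (hc : P.count J = 3)
    {x y x' y' z : Finset (ι × ι)} (hz : z ∈ P.R) (hE : P.E x y) (hE' : P.E y' x')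
    (hxx : res J x' = res J x) (hyy : res J y' = res J y) (hxy : res J x ≠ res J y)
    (hxz : res J x ≠ res J z) (hyz : res J y ≠ res J z) : False := by
  have hx := P.memLeft x y hE
  have hy := P.memRight x y hE
  have hy' := P.memLeft y' x' hE'
  have hx' := P.memRight y' x' hE'
  have hxy' : res J y' ≠ res J x' := by rw [hxx, hyy]; exact hxy.symm
  obtain ⟨a1, a2, -, -⟩ := hJ.edge hE hxy
  obtain ⟨b1, -, -, -⟩ := hJ.edge hE' hxy'
  have hsubD : down J x y ⊆ J := Finset.filter_subset _ _
  have hsubD' : down J y' x' ⊆ J := Finset.filter_subset _ _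
  have hJc : J.card = 6 := by
    unfold Extremal at hJ; rw [hc] at hJ; omega
  rw [res_eq_iff] at hxx hyy
  have hmeet : (down J x y ∩ down J y' x').Nonempty := by
    have := P.inj_of_count_eq hsubD a2 hx hy hxy
    rw [Ne, res_eq_iff] at this
    push Not at this
    obtain ⟨a, ha, b, hb, hab⟩ := this
    have haJ := hsubD ha
    have hbJ := hsubD hb
    have hne : a ≠ b := by
      rintro rfl
      rcases hab with h | h
      · exact P.irr x hx a h.1
      · exact P.irr y hy a h.2
    rcases hab with h | h
    · refine ⟨a, Finset.mem_inter.2 ⟨ha, Finset.mem_filter.2 ⟨haJ, b, hbJ, ?_, ?_⟩⟩⟩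
      · rw [hyy b hbJ a haJ]
        exact (P.total y hy b a hne.symm).2 h.2
      · rw [hxx a haJ b hbJ]
        exact h.1
    · refine ⟨b, Finset.mem_inter.2 ⟨hb, Finset.mem_filter.2 ⟨hbJ, a, haJ, ?_, ?_⟩⟩⟩
      · rw [hyy a haJ b hbJ]
        exact h.2
      · rw [hxx b hbJ a haJ]
        exact (P.total x hx b a hne.symm).2 h.1
  have hun : (down J x y ∪ down J y' x').card < J.card := by
    have h1 := Finset.card_union_add_card_inter (down J x y) (down J y' x')
    have h2 := Finset.card_pos.2 hmeet
    omega
  obtain ⟨g, hg, hgn⟩ : ∃ g ∈ J, g ∉ down J x y ∪ down J y' x' := by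
    by_contra hcon
    push Not at hcon
    exact absurd (Finset.card_le_card hcon) (by omega)
  rw [Finset.mem_union, not_or] at hgn
  have hsame : ∀ h ∈ J, ((g, h) ∈ x ↔ (g, h) ∈ y) := by
    intro h hh
    by_cases hgh : g = h
    · subst hgh
      exact ⟨fun h => absurd h (P.irr x hx g), fun h => absurd h (P.irr y hy g)⟩
    constructor
    · intro h1
      by_contra h2
      refine hgn.2 (Finset.mem_filter.2 ⟨hg, h, hh, ?_, ?_⟩)
      · rw [hyy h hh g hg]
        exact (P.total y hy h g (Ne.symm hgh)).2 h2
      · exact (hxx g hg h hh).2 h1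
    · intro h1
      by_contra h2
      exact hgn.1 (Finset.mem_filter.2 ⟨hg, h, hh, (P.total x hx h g (Ne.symm hgh)).2 h2, h1⟩)
  have hopp : ∀ h ∈ J, g ≠ h → ((g, h) ∈ x ↔ (h, g) ∈ z) := by
    intro h hh hgh
    obtain ⟨p, hp, hp'⟩ := P.flips g h hgh
    obtain ⟨q, hq, hq'⟩ := P.flips h g (Ne.symm hgh)
    have hq'' := (P.total q hq h g (Ne.symm hgh)).1 hq'
    rw [P.total z hz h g (Ne.symm hgh)]
    have e1 := hsame h hh
    rcases res_mem_of_count hx hy hz hxy hxz hyz hc hp with e | e | e <;>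
    rcases res_mem_of_count hx hy hz hxy hxz hyz hc hq with e' | e' | e' <;>
    · have f1 := (res_eq_iff _ _ _).1 e g hg h hh
      have f2 := (res_eq_iff _ _ _).1 e' g hg h hh
      tauto
  set H := J.filter fun h => (g, h) ∈ x
  set L := J.filter fun h => (h, g) ∈ x
  have hHL : H.card + L.card + 1 = J.card := by
    have hd1 : Disjoint H L := by
      rw [Finset.disjoint_left]
      intro h h1 h2
      have h1 := (Finset.mem_filter.1 h1).2
      have h2 := (Finset.mem_filter.1 h2).2
      by_cases hgh : g = h
      · subst hgh; exact P.irr x hx g h1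
      · exact (P.total x hx g h hgh).1 h1 h2
    have hU : H ∪ L = J.erase g := by
      ext h
      simp only [H, L, Finset.mem_union, Finset.mem_filter, Finset.mem_erase]
      constructor
      · rintro (⟨h1, h2⟩ | ⟨h1, h2⟩)
        · exact ⟨fun e => P.irr x hx g (by rw [e] at h2; exact h2), h1⟩
        · exact ⟨fun e => P.irr x hx g (by rw [e] at h2; exact h2), h1⟩
      · rintro ⟨h1, h2⟩
        by_cases h3 : (g, h) ∈ x
        · exact Or.inl ⟨h2, h3⟩
        · exact Or.inr ⟨h2, (P.total x hx h g h1).2 h3⟩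
    rw [← Finset.card_union_of_disjoint hd1, hU, Finset.card_erase_add_one hg]
  have hxe : ∀ p ∈ P.R, res J p ≠ res J z → ∀ h ∈ J, ((g, h) ∈ p ↔ (g, h) ∈ x) := by
    intro p hp hpz h hh
    rcases res_mem_of_count hx hy hz hxy hxz hyz hc hp with e | e | e
    · exact (res_eq_iff _ _ _).1 e g hg h hh
    · rw [hsame h hh]; exact (res_eq_iff _ _ _).1 e g hg h hh
    · exact absurd e hpz
  have hHx : ∀ h ∈ H, h ∈ J ∧ g ≠ h ∧ (g, h) ∈ x := by
    intro h hh
    obtain ⟨h1, h2⟩ := Finset.mem_filter.1 hh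
    exact ⟨h1, fun e => P.irr x hx g (by rw [← e] at h2; exact h2), h2⟩
  have hLx : ∀ h ∈ L, h ∈ J ∧ g ≠ h ∧ (g, h) ∉ x := by
    intro h hh
    obtain ⟨h1, h2⟩ := Finset.mem_filter.1 hh
    have hgh : g ≠ h := fun e => P.irr x hx g (by rw [← e] at h2; exact h2)
    exact ⟨h1, hgh, (P.total x hx h g hgh.symm).1 h2⟩
  have hin : H.card ≤ 3 ∧ (L.Nonempty → H.card + 1 ≤ 3) := by
    obtain ⟨p, q, hpq, hp, hq⟩ := P.exists_edge_res' hz ⟨x, hx, hxz⟩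
    have hpR := P.memLeft _ _ hpq
    have hqR := P.memRight _ _ hpq
    have hcard := (hJ.edge hpq (by rw [hq]; exact hp)).1
    rw [hc] at hcard
    rw [res_eq_iff] at hq
    have hsub : H ⊆ down J p q := by
      intro h hh
      obtain ⟨h1, h2, h3⟩ := hHx h hh
      refine Finset.mem_filter.2 ⟨h1, g, hg, (hxe p hpR hp h h1).2 h3, ?_⟩
      rw [hq h h1 g hg, ← hopp h h1 h2]
      exact h3
    refine ⟨hcard ▸ Finset.card_le_card hsub, ?_⟩
    rintro ⟨l, hl⟩
    obtain ⟨h1, h2, h3⟩ := hLx l hl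
    have hgd : g ∈ down J p q := by
      refine Finset.mem_filter.2 ⟨hg, l, h1, ?_, ?_⟩
      · rw [P.total p hpR l g h2.symm, hxe p hpR hp l h1]
        exact h3
      · rw [hq g hg l h1, P.total z hz g l h2, ← hopp l h1 h2]
        exact h3
    have hgH : g ∉ H := fun hh => (hHx g hh).2.1 rfl
    rw [← Finset.card_insert_of_notMem hgH, ← hcard]
    exact Finset.card_le_card (Finset.insert_subset hgd hsub)
  have hout : L.card ≤ 3 ∧ (H.Nonempty → L.card + 1 ≤ 3) := by
    obtain ⟨q, p, hpq, hq, hp⟩ := P.exists_edge_res hz ⟨x, hx, hxz⟩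
    have hpR := P.memRight _ _ hpq
    have hqR := P.memLeft _ _ hpq
    have hcard := (hJ.edge hpq (by rw [hq]; exact hp.symm)).1
    rw [hc] at hcard
    rw [res_eq_iff] at hq
    have hsub : L ⊆ down J q p := by
      intro h hh
      obtain ⟨h1, h2, h3⟩ := hLx h hh
      refine Finset.mem_filter.2 ⟨h1, g, hg, ?_, ?_⟩
      · rw [hq g hg h h1, P.total z hz g h h2, ← hopp h h1 h2]
        exact h3
      · rw [P.total p hpR h g h2.symm, hxe p hpR hp h h1]
        exact h3
    refine ⟨hcard ▸ Finset.card_le_card hsub, ?_⟩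
    rintro ⟨l, hl⟩
    obtain ⟨h1, h2, h3⟩ := hHx l hl
    have hgd : g ∈ down J q p := by
      refine Finset.mem_filter.2 ⟨hg, l, h1, ?_, (hxe p hpR hp l h1).2 h3⟩
      rw [hq l h1 g hg, ← hopp l h1 h2]
      exact h3
    have hgL : g ∉ L := fun hh => (hLx g hh).2.1 rfl
    rw [← Finset.card_insert_of_notMem hgL, ← hcard]
    exact Finset.card_le_card (Finset.insert_subset hgd hsub)
  rcases Nat.eq_zero_or_pos H.card with h0 | h0
  · omega
  · rcases Nat.eq_zero_or_pos L.card with h1 | h1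
    · omega
    · have := hin.2 (Finset.card_pos.1 h1)
      have := hout.2 (Finset.card_pos.1 h0)
      omega

theorem Extremal.deterministic {J : Finset ι} (hJ : P.Extremal J) {v v' w w' : Finset (ι × ι)}
    (hE : P.E v w) (hE' : P.E v' w') (hv : res J v' = res J v) (hw : res J w ≠ res J v)
    (hw' : res J w' ≠ res J v) : res J w = res J w' := by
  induction hk : P.count J using Nat.strong_induction_on generalizing J with
  | _ K ih =>
  by_contra hww
  have mv := P.memLeft _ _ hE
  have mw := P.memRight _ _ hE
  have mw' := P.memRight _ _ hE'
  have hsub : ({res J v, res J w, res J w'} : Finset _) ⊆ P.R.image (res J) := by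
    intro a ha
    simp only [Finset.mem_insert, Finset.mem_singleton] at ha
    rcases ha with rfl | rfl | rfl <;> exact Finset.mem_image_of_mem _ ‹_›
  have hcard3 : ({res J v, res J w, res J w'} : Finset (Finset (ι × ι))).card = 3 :=
    Finset.card_eq_three.2 ⟨_, _, _, hw.symm, hw'.symm, hww, rfl⟩
  have hK3 : 3 ≤ P.count J := hcard3 ▸ Finset.card_le_card hsub
  rcases hK3.eq_or_lt with h3 | h4
  · have h3 := h3.symm
    have hthree := fun u hu => res_mem_of_count (u := u) mv mw mw' hw.symm hw'.symm hww h3 hu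
    obtain ⟨p, q, hpq, hp, hq⟩ := P.exists_edge_res mw ⟨v, mv, hw.symm⟩
    rcases hthree q (P.memRight _ _ hpq) with e | e | e
    · exact hJ.no_two_cycle h3 mw' hE hpq e hp hw.symm hw'.symm hww
    · exact hq e
    · obtain ⟨p', q', hpq', hp', hq'⟩ := P.exists_edge_res mw' ⟨v, mv, hw'.symm⟩
      rcases hthree q' (P.memRight _ _ hpq') with e' | e' | e'
      · exact hJ.no_two_cycle h3 mw hE' hpq' (e'.trans hv.symm) hp' (by rw [hv]; exact hw'.symm)
          (by rw [hv]; exact hw.symm) (Ne.symm hww)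
      · refine hJ.no_two_cycle h3 mv hpq hpq' (e'.trans hp.symm) (hp'.trans e.symm) ?_ ?_ ?_
        · rw [hp, e]; exact hww
        · rw [hp]; exact hw
        · rw [e]; exact hw'
      · exact hq' e'
  · obtain ⟨z0, hz0, hz0n⟩ : ∃ z ∈ P.R.image (res J),
        z ∉ ({res J v, res J w, res J w'} : Finset (Finset (ι × ι))) := by
      by_contra hcon
      push Not at hcon
      have := Finset.card_le_card hcon
      unfold count at h4
      omega
    obtain ⟨z1, hz1, rfl⟩ := Finset.mem_image.1 hz0
    simp only [Finset.mem_insert, Finset.mem_singleton, not_or] at hz0n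
    obtain ⟨z, y, hzy, hz, hy⟩ := P.exists_edge_res hz1 ⟨v, mv, Ne.symm hz0n.1⟩
    rw [← hz] at hz0n hy
    have mz := P.memLeft _ _ hzy
    have my := P.memRight _ _ hzy
    obtain ⟨-, -, a3, a4⟩ := hJ.edge hzy hy.symm
    have hid := fun (a b : Finset (ι × ι)) (ha : a ∈ P.R) (hb : b ∈ P.R)
        (hab : res J a ≠ res J b) (haz : res J z ≠ res J a) (hbz : res J z ≠ res J b) =>
      show res (J \ down J z y) a ≠ res (J \ down J z y) b from fun h =>
        (P.identified Finset.sdiff_subset mz my hy.symm (P.down_compl mz my J) a3 ha hb hab h).elim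
          (fun h => haz h.1.symm) (fun h => hbz h.2.symm)
    have hsv : res (J \ down J z y) v' = res (J \ down J z y) v := by
      rw [← res_res Finset.sdiff_subset v', hv, res_res Finset.sdiff_subset]
    exact hid w w' mw mw' hww hz0n.2.1 hz0n.2.2
      (ih _ (by omega) a4 hsv (hid w v mw mv hw hz0n.2.1 hz0n.1)
        (hid w' v mw' mv hw' hz0n.2.2 hz0n.1) rfl)

end PatSys

/-- If each `b ≠ a` in `J` drops below `a` at time `y b`, one can select as many times as elements
of `J` at which the sets of elements below `a` are pairwise distinct. -/
theorem exists_separating_times {ι : Type*} {J : Finset ι} {a : ι} (y : ι → ℕ)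
    (hy : Set.InjOn y J) (ha : a ∈ J) {N s : ℕ} (hN : ∀ i ∈ J, N + 1 ≤ y i ∧ y i < s)
    (L : ι → ℕ → Prop) (h1 : ∀ i ∈ J, i ≠ a → ¬ L i (y i - 1) ∧ L i (y i))
    (h2 : ∀ i ∈ J, ∀ m, y i ≤ m → m < y a → L i m)
    (h3 : ∀ i ∈ J, ∀ m, y a ≤ m → m < y i → ¬ L i m)
    (h4 : ∀ i ∈ J, y i < y a → ∀ m, y a ≤ m → m < s → (L i m ↔ L i (y a))) :
    ∃ τ : ι → ℕ, (∀ i ∈ J, N ≤ τ i) ∧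
      ∀ i ∈ J, ∀ j ∈ J, i ≠ j → ∃ b ∈ J, ¬ (L b (τ i) ↔ L b (τ j)) := by
  classical
  set U := J.filter fun i => y i < y a ∧ ¬ L i (y a) with hU
  obtain ⟨Z, hZ1, hZ2⟩ : ∃ Z : ι → Prop, (∀ i, Z i → i ∈ U ∧ ∀ j ∈ U, y i ≤ y j) ∧
      (U.Nonempty → ∃ i, Z i) := by
    refine ⟨fun i => i ∈ U ∧ ∀ j ∈ U, y i ≤ y j, fun i h => h, fun h => ?_⟩
    exact U.exists_min_image y h
  have hZ3 : ∀ i, Z i → i ∈ J ∧ y i < y a ∧ ¬ L i (y a) ∧ L i (y a - 1) := by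
    intro i hi
    obtain ⟨b1, b2, b3⟩ := Finset.mem_filter.1 (hZ1 i hi).1
    exact ⟨b1, b2, b3, h2 i b1 _ (by omega) (by omega)⟩
  let τ : ι → ℕ := fun i => if Z i then y a - 1 else if y i < y a then y i - 1 else y i
  have t1 : ∀ i, Z i → τ i = y a - 1 := fun i hi => by simp [τ, hi]
  have t2 : ∀ i, ¬ Z i → y i < y a → τ i = y i - 1 := fun i hi h => by simp [τ, hi, h]
  have t3 : ∀ i, y a ≤ y i → τ i = y i := fun i h => by
    have : ¬ Z i := fun hz => by have := (hZ3 i hz).2.1; omega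
    simp [τ, this, Nat.not_lt.2 h]
  have key : ∀ i ∈ J, ∀ j ∈ J, y i < y j → ∃ b ∈ J, ¬ (L b (τ i) ↔ L b (τ j)) := by
    intro i hi j hj hij
    have Ni := hN i hi
    have Nj := hN j hj
    have Na := hN a ha
    rcases Nat.lt_or_ge (y i) (y a) with hia | hia
    · have hia' : i ≠ a := fun h => by subst h; omega
      rcases Nat.lt_or_ge (y j) (y a) with hja | hja
      · have hja' : j ≠ a := fun h => by subst h; omega
        by_cases zi : Z i
        · have zj : ¬ Z j := fun zj => by
            have := (hZ1 j zj).2 i (hZ1 i zi).1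
            omega
          refine ⟨j, hj, ?_⟩
          rw [t1 i zi, t2 j zj hja]
          have e1 := (h1 j hj hja').1
          have e2 := h2 j hj (y a - 1) (by omega) (by omega)
          tauto
        · refine ⟨i, hi, ?_⟩
          rw [t2 i zi hia]
          have e1 := (h1 i hi hia').1
          have e2 : L i (τ j) := by
            by_cases zj : Z j
            · rw [t1 j zj]; exact h2 i hi _ (by omega) (by omega)
            · rw [t2 j zj hja]; exact h2 i hi _ (by omega) (by omega)
          tauto
      · rw [t3 j hja]
        by_cases zi : Z i
        · refine ⟨i, hi, ?_⟩
          obtain ⟨-, c1, c2, c3⟩ := hZ3 i zi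
          rw [t1 i zi, h4 i hi c1 (y j) hja (by omega)]
          tauto
        · rw [t2 i zi hia]
          by_cases hiU : L i (y a)
          · refine ⟨i, hi, ?_⟩
            rw [h4 i hi hia (y j) hja (by omega)]
            have e1 := (h1 i hi hia').1
            tauto
          · have hiU' : i ∈ U := Finset.mem_filter.2 ⟨hi, hia, hiU⟩
            obtain ⟨z, hz⟩ := hZ2 ⟨i, hiU'⟩
            obtain ⟨c0, c1, c2, c3⟩ := hZ3 z hz
            have hzi : y z < y i := by
              refine lt_of_le_of_ne ((hZ1 z hz).2 i hiU') fun he => ?_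
              have := hy (Finset.mem_coe.2 c0) (Finset.mem_coe.2 hi) he
              exact zi (this ▸ hz)
            refine ⟨z, c0, ?_⟩
            rw [h4 z c0 c1 (y j) hja (by omega)]
            have e1 := h2 z c0 (y i - 1) (by omega) (by omega)
            tauto
    · have hja' : j ≠ a := fun h => by subst h; omega
      refine ⟨j, hj, ?_⟩
      rw [t3 i hia, t3 j (by omega)]
      have e1 := (h1 j hj hja').2
      have e2 := h3 j hj (y i) hia hij
      tauto
  refine ⟨τ, fun i hi => ?_, fun i hi j hj hij => ?_⟩
  · have := hN i hi
    have := hN a ha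
    by_cases zi : Z i
    · rw [t1 i zi]; omega
    · rcases Nat.lt_or_ge (y i) (y a) with h | h
      · rw [t2 i zi h]; omega
      · rw [t3 i h]; omega
  · rcases Nat.lt_or_ge (y i) (y j) with h | h
    · exact key i hi j hj h
    · have hne : y j ≠ y i := fun he =>
        hij (hy (Finset.mem_coe.2 hi) (Finset.mem_coe.2 hj) he.symm)
      obtain ⟨b, hb, hb'⟩ := key j hj i hi (by omega)
      exact ⟨b, hb, fun h => hb' h.symm⟩

section Pattern

variable {ι : Type*} [Fintype ι]

open Classical in
/-- The order pattern of the functions `ψ_{α i}` at the integer time `m`. -/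
noncomputable def pat (α : ι → ℝ) (m : ℕ) : Finset (ι × ι) :=
  Finset.univ.filter fun p => psiN (α p.1) m < psiN (α p.2) m

theorem mem_pat (α : ι → ℝ) (m : ℕ) (i j : ι) :
    (i, j) ∈ pat α m ↔ psiN (α i) m < psiN (α j) m := by
  simp [pat]

open Classical in
/-- The patterns occurring at arbitrarily large times. -/
noncomputable def recPats (α : ι → ℝ) : Finset (Finset (ι × ι)) :=
  Finset.univ.filter fun v => ∀ N, ∃ m, N ≤ m ∧ pat α m = v

theorem mem_recPats (α : ι → ℝ) (v : Finset (ι × ι)) :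
    v ∈ recPats α ↔ ∀ N, ∃ m, N ≤ m ∧ pat α m = v := by
  simp [recPats]

/-- `w` immediately follows `v` at arbitrarily large times. -/
def RecEdge (α : ι → ℝ) (v w : Finset (ι × ι)) : Prop :=
  ∀ N, ∃ m, N ≤ m ∧ pat α m = v ∧ pat α (m + 1) = w

theorem exists_eventually_recurrent {X : Type*} [Finite X] (g : ℕ → X) :
    ∃ M, ∀ m, M ≤ m → ∀ N, ∃ m', N ≤ m' ∧ g m' = g m := by
  classical
  have : Fintype X := Fintype.ofFinite X
  have h : ∀ x : X, ∃ M, (∀ N, ∃ m', N ≤ m' ∧ g m' = x) ∨ ∀ m, M ≤ m → g m ≠ x := by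
    intro x
    by_cases hx : ∀ N, ∃ m', N ≤ m' ∧ g m' = x
    · exact ⟨0, Or.inl hx⟩
    · push Not at hx
      obtain ⟨N, hN⟩ := hx
      exact ⟨N, Or.inr hN⟩
  choose M hM using h
  refine ⟨Finset.univ.sup M, fun m hm => ?_⟩
  rcases hM (g m) with h1 | h1
  · exact h1
  · exact absurd rfl (h1 m ((Finset.le_sup (Finset.mem_univ (g m))).trans hm))

theorem exists_recEdge (α : ι → ℝ) :
    ∃ M, ∀ m, M ≤ m → RecEdge α (pat α m) (pat α (m + 1)) := by
  obtain ⟨M, hM⟩ := exists_eventually_recurrent fun m => (pat α m, pat α (m + 1))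
  refine ⟨M, fun m hm N => ?_⟩
  obtain ⟨m', h1, h2⟩ := hM m hm N
  exact ⟨m', h1, congrArg Prod.fst h2, congrArg Prod.snd h2⟩

theorem RecEdge.left {α : ι → ℝ} {v w : Finset (ι × ι)} (h : RecEdge α v w) : v ∈ recPats α := by
  rw [mem_recPats]
  intro N
  obtain ⟨m, h1, h2, -⟩ := h N
  exact ⟨m, h1, h2⟩

theorem RecEdge.right {α : ι → ℝ} {v w : Finset (ι × ι)} (h : RecEdge α v w) :
    w ∈ recPats α := by
  rw [mem_recPats]
  intro N
  obtain ⟨m, h1, -, h2⟩ := h N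
  exact ⟨m + 1, by omega, h2⟩

theorem exists_uniform_bound {X : Type*} [Finite X] {p : X → ℕ → Prop}
    (h : ∀ x, ∃ M, ∀ m, M ≤ m → p x m) : ∃ M, ∀ m, M ≤ m → ∀ x, p x m := by
  classical
  have : Fintype X := Fintype.ofFinite X
  choose M hM using h
  exact ⟨Finset.univ.sup M, fun m hm x =>
    hM x m ((Finset.le_sup (Finset.mem_univ x)).trans hm)⟩

theorem exists_bound_common_pred {α : ι → ℝ} (hα : ∀ i, Irrational (α i))
    (hd : ∃ M, ∀ m, M ≤ m → ∀ i j, i ≠ j → psiN (α i) m ≠ psiN (α j) m) :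
    ∃ M, ∀ s, M ≤ s → ∀ i j, i ≠ j → ∀ r, ¬ (ConsDen (α i) r s ∧ ConsDen (α j) r s) := by
  obtain ⟨M0, hM0⟩ := hd
  obtain ⟨M, hM⟩ := exists_uniform_bound (X := ι × ι)
    (p := fun x s => x.1 ≠ x.2 → ∀ r, ¬ (ConsDen (α x.1) r s ∧ ConsDen (α x.2) r s)) (by
      rintro ⟨i, j⟩
      by_cases hij : i = j
      · exact ⟨0, fun m _ h => absurd hij h⟩
      · obtain ⟨M, hM⟩ := exists_not_common_pred (hα i) (hα j)
          ⟨M0, fun m hm => hM0 m hm i j hij⟩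
        exact ⟨M, fun m hm _ => hM m hm⟩)
  exact ⟨M, fun s hs i j => hM s hs (i, j)⟩

theorem exists_bound_pred_ge {α : ι → ℝ} (hα : ∀ i, Irrational (α i)) (N : ℕ) :
    ∃ M, ∀ s, M ≤ s → ∀ i r, ConsDen (α i) r s → N ≤ r :=
  exists_uniform_bound fun i => exists_pred_ge (hα i) N

theorem card_le_of_isDen [DecidableEq ι] {α : ι → ℝ} (hα : ∀ i, Irrational (α i))
    (hd : ∃ M, ∀ m, M ≤ m → ∀ i j, i ≠ j → psiN (α i) m ≠ psiN (α j) m) :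
    ∃ M, ∀ s, M ≤ s → ∀ J : Finset ι, (∀ i ∈ J, IsDen (α i) s) →
      J.card ≤ ((recPats α).image fun x => x ∩ (J ×ˢ J)).card := by
  classical
  obtain ⟨M1, hM1⟩ := exists_bound_common_pred hα hd
  obtain ⟨M0, hM0⟩ := hd
  obtain ⟨M2, hM2⟩ := exists_recEdge α
  obtain ⟨M3, hM3⟩ := exists_bound_pred_ge hα (M0 + M2 + 2)
  refine ⟨M1 + M3 + 2, fun s hs J hJ => ?_⟩
  rcases J.eq_empty_or_nonempty with rfl | hne
  · simp
  obtain ⟨a, ha, hmin⟩ := J.exists_min_image (fun i => psiN (α i) s) hne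
  have hex : ∀ i, ∃ r, i ∈ J → ConsDen (α i) r s := by
    intro i
    by_cases hi : i ∈ J
    · obtain ⟨r, hr⟩ := exists_predDen (hJ i hi) (by omega)
      exact ⟨r, fun _ => hr⟩
    · exact ⟨0, fun h => absurd h hi⟩
  choose y hy using hex
  have hyN : ∀ i ∈ J, M0 + M2 + 1 + 1 ≤ y i ∧ y i < s := fun i hi =>
    ⟨hM3 s (by omega) i (y i) (hy i hi), (hy i hi).2.2.1⟩
  have hinj : Set.InjOn y J := by
    intro i hi j hj hij
    by_contra hij'
    have h1 := hy i hi
    have h2 := hy j hj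
    rw [hij] at h1
    exact hM1 s (by omega) i j hij' _ ⟨h1, h2⟩
  have hsep : ∃ τ : ι → ℕ, (∀ i ∈ J, M0 + M2 + 1 ≤ τ i) ∧ ∀ i ∈ J, ∀ j ∈ J, i ≠ j → ∃ b ∈ J,
      ¬ (psiN (α b) (τ i) < psiN (α a) (τ i) ↔ psiN (α b) (τ j) < psiN (α a) (τ j)) := by
    refine exists_separating_times y hinj ha hyN (fun i m => psiN (α i) m < psiN (α a) m)
      ?_ ?_ ?_ ?_
    · intro i hi hia
      have hn := hyN i hi
      have hlt : psiN (α a) s < psiN (α i) s :=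
        lt_of_le_of_ne (hmin i hi) (hM0 s (by omega) a i (Ne.symm hia))
      have h := flip_at_pred (hα a) (hα i) (by omega) (hy i hi) (hJ a ha) hlt
        (hM0 _ (by omega) a i (Ne.symm hia)) (hM0 _ (by omega) a i (Ne.symm hia))
      exact ⟨not_lt.2 h.1.le, h.2⟩
    · intro i hi m h1 h2
      have hn := hyN a ha
      obtain ⟨u, hu⟩ := exists_predDen (hy a ha).1 (by omega)
      exact lt_of_consDen_of_mem (hα i) (hα a) (hy i hi) hu (hy a ha) h1 h2
    · intro i hi m h1 h2
      have hn := hyN i hi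
      obtain ⟨u, hu⟩ := exists_predDen (hy i hi).1 (by omega)
      exact not_lt.2 (lt_of_consDen_of_mem (hα a) (hα i) (hy a ha) hu (hy i hi) h1 h2).le
    · intro i hi hia m h1 h2
      have hn := hyN a ha
      have c1 := hy i hi
      have c2 := hy a ha
      rw [c1.2.2.2 m (by omega) h2, c1.2.2.2 (y a) (by omega) (by omega), c2.2.2.2 m h1 h2]
  obtain ⟨τ, hτ1, hτ2⟩ := hsep
  refine Finset.card_le_card_of_injOn (fun i => pat α (τ i) ∩ (J ×ˢ J)) ?_ ?_
  · intro i hi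
    have := hτ1 i hi
    exact Finset.mem_coe.2 (Finset.mem_image_of_mem _ (hM2 (τ i) (by omega)).left)
  · intro i hi j hj hij
    by_contra hne
    obtain ⟨b, hb, hb'⟩ := hτ2 i hi j hj hne
    have := Finset.ext_iff.1 hij (b, a)
    simp only [Finset.mem_inter, Finset.mem_product, hb, ha, and_self, and_true,
      mem_pat] at this
    exact hb' this

/-- The pattern system of an eventually pairwise distinct tuple. -/
noncomputable def patSys [DecidableEq ι] (α : ι → ℝ) (hα : ∀ i, Irrational (α i))
    (hd : ∃ M, ∀ m, M ≤ m → ∀ i j, i ≠ j → psiN (α i) m ≠ psiN (α j) m) : PatSys ι where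
  R := recPats α
  E := RecEdge α
  memLeft _ _ h := h.left
  memRight _ _ h := h.right
  irr v hv i hi := by
    obtain ⟨m, -, rfl⟩ := (mem_recPats α v).1 hv 0
    rw [mem_pat] at hi
    exact lt_irrefl _ hi
  total v hv i j hij := by
    obtain ⟨M, hM⟩ := hd
    obtain ⟨m, hm, rfl⟩ := (mem_recPats α v).1 hv M
    rw [mem_pat, mem_pat, not_lt]
    have := hM m hm i j hij
    exact ⟨le_of_lt, fun h => lt_of_le_of_ne h this⟩
  nonempty := by
    obtain ⟨M, hM⟩ := exists_recEdge α
    exact ⟨_, (hM M le_rfl).left⟩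
  connected A := by
    rintro ⟨v, hv, hAv⟩ ⟨w, hw, hAw⟩
    obtain ⟨M, hM⟩ := exists_recEdge α
    obtain ⟨m, hm, rfl⟩ := (mem_recPats α v).1 hv M
    obtain ⟨m', hm', rfl⟩ := (mem_recPats α w).1 hw m
    by_contra hcon
    push Not at hcon
    refine hAw (Nat.le_induction hAv (fun x hx hAx => ?_) m' hm')
    exact hcon _ _ (hM x (hm.trans hx)) hAx
  flips i j hij := by
    obtain ⟨M, hM⟩ := exists_recEdge α
    obtain ⟨M', hM'⟩ := hd
    obtain ⟨m, hm, hle⟩ := not_eventually_lt (hα j) (hα i) (M + M')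
    refine ⟨_, (hM m (by omega)).left, ?_⟩
    rw [mem_pat]
    exact lt_of_le_of_ne hle (hM' m (by omega) i j hij)
  descent v w hE J hJ := by
    obtain ⟨M, hM⟩ := card_le_of_isDen hα hd
    obtain ⟨m, hm, rfl, rfl⟩ := hE (M + 1)
    refine hM (m + 1) (by omega) J fun i hi => ?_
    obtain ⟨j, h1, h2⟩ := hJ i hi
    rw [mem_pat] at h1 h2
    refine isDen_of_jump (by omega) ?_
    have := psiN_anti (α j) (m := m) (m' := m + 1) (by omega) (by omega)
    linarith

end Pattern

theorem psi_natCast (α : ℝ) (m : ℕ) : psi α m = psiN α m := rfl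

theorem IsOrderVec.lt_iff {n : ℕ} {α : Fin n → ℝ} {t : ℝ} {v : Fin n → Fin n}
    (h : IsOrderVec α t v) (a b : Fin n) : psi (α (v a)) t < psi (α (v b)) t ↔ b < a := by
  have : StrictAnti fun a => psi (α (v a)) t := fun a b hab => h.2 a b hab
  exact this.lt_iff_gt

theorem exists_isOrderVec {n : ℕ} (α : Fin n → ℝ) (t : ℝ)
    (h : ∀ i j, i ≠ j → psi (α i) t ≠ psi (α j) t) : ∃ v, IsOrderVec α t v := by
  refine ⟨Tuple.sort fun i => - psi (α i) t, (Tuple.sort _).bijective, fun p q hpq => ?_⟩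
  have h1 := Tuple.monotone_sort (fun i => - psi (α i) t) hpq.le
  simp only [Function.comp] at h1
  refine lt_of_le_of_ne (by linarith) (h _ _ fun he => ?_)
  exact hpq.ne' ((Tuple.sort fun i => - psi (α i) t).injective he)

theorem IsOrderVec.of_pat {n : ℕ} {α : Fin n → ℝ} {m m' : ℕ} {v : Fin n → Fin n}
    (h : IsOrderVec α m v) (hp : pat α m = pat α m') : IsOrderVec α m' v := by
  refine ⟨h.1, fun p q hpq => ?_⟩
  have h1 := h.2 p q hpq
  rw [gt_iff_lt, psi_natCast, psi_natCast, ← mem_pat] at h1 ⊢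
  rwa [← hp]

theorem PairwiseIndependent.eventually {n : ℕ} {α : Fin n → ℝ} (h : PairwiseIndependent α) :
    ∃ M, ∀ m : ℕ, M ≤ m → ∀ i j, i ≠ j → psiN (α i) m ≠ psiN (α j) m := by
  obtain ⟨T, -, hT⟩ := h
  obtain ⟨M, hM⟩ := exists_nat_ge T
  exact ⟨M, fun m hm i j hij => hT m (hM.trans (by exact_mod_cast hm)) i j hij⟩

theorem card_recPats_le {n : ℕ} {α : Fin n → ℝ} (h : PairwiseIndependent α) :
    (recPats α).card ≤ kAlpha α := by
  classical
  obtain ⟨M, hM⟩ := h.eventually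
  have hex : ∀ p : Finset (Fin n × Fin n), ∃ v, p ∈ recPats α →
      ∃ m, pat α m = p ∧ IsOrderVec α m v := by
    intro p
    by_cases hp : p ∈ recPats α
    · obtain ⟨m, hm, hmp⟩ := (mem_recPats α p).1 hp M
      obtain ⟨v, hv⟩ := exists_isOrderVec α m fun i j hij => hM m hm i j hij
      exact ⟨v, fun _ => ⟨m, hmp, hv⟩⟩
    · exact ⟨id, fun h => absurd h hp⟩
  choose V hV using hex
  have hfin : {v : Fin n → Fin n | OccursInfinitely α v}.Finite := Set.toFinite _
  unfold kAlpha
  rw [Nat.card_coe_set_eq, Set.ncard_eq_toFinset_card _ hfin]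
  refine Finset.card_le_card_of_injOn V ?_ ?_
  · intro p hp
    obtain ⟨m, hm1, hm2⟩ := hV p hp
    simp only [Set.Finite.coe_toFinset]
    intro T
    obtain ⟨N, hN⟩ := exists_nat_gt T
    obtain ⟨m', hm', hmp⟩ := (mem_recPats α p).1 hp N
    exact ⟨m', hN.trans_le (by exact_mod_cast hm'), hm2.of_pat (hm1.trans hmp.symm)⟩
  · intro p hp p' hp' hpp
    obtain ⟨m, rfl, hm2⟩ := hV p hp
    obtain ⟨m', rfl, hm2'⟩ := hV p' hp'
    rw [← hpp] at hm2'
    ext ⟨i, j⟩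
    obtain ⟨a, rfl⟩ := hm2.1.2 i
    obtain ⟨b, rfl⟩ := hm2.1.2 j
    rw [mem_pat, mem_pat, ← psi_natCast, ← psi_natCast, ← psi_natCast, ← psi_natCast,
      hm2.lt_iff, hm2'.lt_iff]

theorem periodic_of_deterministic {X : Type*} [DecidableEq X] (q : ℕ → X) (R : Finset X)
    (hR : ∀ t, q t ∈ R) (hrec : ∀ x ∈ R, ∀ N, ∃ t, N ≤ t ∧ q t = x)
    (hdet : ∀ t t', q t = q t' → q (t + 1) = q (t' + 1)) (t t' : ℕ) :
    q t = q t' ↔ t ≡ t' [MOD R.card] := by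
  have hex : ∃ p, 1 ≤ p ∧ q p = q 0 := hrec _ (hR 0) 1
  obtain ⟨p, ⟨hp1, hp2⟩, hmin⟩ : ∃ p, (1 ≤ p ∧ q p = q 0) ∧ ∀ p', 1 ≤ p' → p' < p → q p' ≠ q 0 :=
    ⟨Nat.find hex, Nat.find_spec hex, fun p' h1 h2 h3 => Nat.find_min hex h2 ⟨h1, h3⟩⟩
  have hadd : ∀ a b x, q a = q b → q (a + x) = q (b + x) := by
    intro a b x h
    induction x with
    | zero => exact h
    | succ x ih => exact hdet _ _ ih
  have hmul : ∀ c x, q (p * c + x) = q x := by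
    intro c x
    induction c with
    | zero => simp
    | succ c ih =>
      have := hadd p 0 (p * c + x) hp2
      rw [zero_add] at this
      rw [← ih, ← this]
      congr 1
      ring
  have hmod : ∀ x, q x = q (x % p) := fun x => by
    conv_lhs => rw [← Nat.div_add_mod x p]
    exact hmul _ _
  have hinj : ∀ a b, a < b → b < p → q a ≠ q b := by
    intro a b hab hb h
    have h1 := hadd a b (p - b) h
    rw [show b + (p - b) = p by omega, hp2] at h1
    exact hmin (a + (p - b)) (by omega) (by omega) h1
  have hcard : R.card = p := by
    have himg : (Finset.range p).image q = R := by
      apply Finset.Subset.antisymm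
      · intro x hx
        obtain ⟨t, -, rfl⟩ := Finset.mem_image.1 hx
        exact hR t
      · intro x hx
        obtain ⟨t, -, rfl⟩ := hrec x hx 0
        rw [hmod]
        exact Finset.mem_image_of_mem _ (Finset.mem_range.2 (Nat.mod_lt _ hp1))
    rw [← himg, Finset.card_image_of_injOn, Finset.card_range]
    intro a ha b hb hab
    rw [Finset.mem_coe, Finset.mem_range] at ha hb
    rcases lt_trichotomy a b with h | h | h
    · exact absurd hab (hinj a b h hb)
    · exact h
    · exact absurd hab.symm (hinj b a h ha)
  rw [hcard, hmod t, hmod t']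
  unfold Nat.ModEq
  constructor
  · intro h
    have h1 := Nat.mod_lt t hp1
    have h2 := Nat.mod_lt t' hp1
    rcases lt_trichotomy (t % p) (t' % p) with h3 | h3 | h3
    · exact absurd h (hinj _ _ h3 h2)
    · exact h3
    · exact absurd h.symm (hinj _ _ h3 h1)
  · intro h
    rw [h]

/-- The moments of pattern change and the periodic sequence of patterns. -/
structure CyclicData {ι : Type*} [Fintype ι] [DecidableEq ι] (α : ι → ℝ) (k N : ℕ) where
  S : ℕ → ℕ
  q : ℕ → Finset (ι × ι)
  bound : ∀ t, N < S t
  mono : StrictMono S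
  pat_eq : ∀ t m, S t ≤ m → m < S (t + 1) → pat α m = q (t + 1)
  pat_pred : ∀ t, pat α (S t - 1) = q t
  period : ∀ t t', q t = q t' ↔ t ≡ t' [MOD k]
  edge : ∀ t, RecEdge α (q t) (q (t + 1))
  surj : ∀ v ∈ recPats α, ∃ t, q t = v

theorem exists_cyclicData {ι : Type*} [Fintype ι] [DecidableEq ι] {α : ι → ℝ} {k : ℕ}
    (hk : 2 ≤ k) (hα : ∀ i, Irrational (α i))
    (hd : ∃ M, ∀ m, M ≤ m → ∀ i j, i ≠ j → psiN (α i) m ≠ psiN (α j) m)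
    (hcard : (recPats α).card = k) (hext : (patSys α hα hd).Extremal Finset.univ) (N : ℕ) :
    Nonempty (CyclicData α k N) := by
  classical
  obtain ⟨M, hM⟩ := exists_recEdge α
  let C : ℕ → Prop := fun m => N + M < m ∧ pat α m ≠ pat α (m - 1)
  have hinf : {m | C m}.Infinite := by
    obtain ⟨v, hv, w, hw, hvw⟩ := Finset.one_lt_card.1 (by omega : 1 < (recPats α).card)
    obtain ⟨x, y, hE, hx, hy⟩ := (patSys α hα hd).connected (fun z => z = v) ⟨v, hv, rfl⟩
      ⟨w, hw, hvw.symm⟩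
    rw [Set.infinite_iff_exists_gt]
    intro L
    obtain ⟨m, hm, h1, h2⟩ := (show RecEdge α x y from hE) (L + N + M)
    refine ⟨m + 1, ⟨by omega, ?_⟩, by omega⟩
    rw [Nat.add_sub_cancel, h1, h2, hx]
    exact hy
  let S : ℕ → ℕ := Nat.nth C
  have hS : ∀ t, C (S t) := fun t => Nat.nth_mem_of_infinite hinf t
  have hmono : StrictMono S := Nat.nth_strictMono hinf
  have hconst : ∀ t m, S t ≤ m → m < S (t + 1) → pat α m = pat α (S t) := by
    intro t m hm
    induction m, hm using Nat.le_induction with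
    | base => intro _; rfl
    | succ m hm ih =>
      intro hlt
      rw [← ih (by omega)]
      by_contra hne
      have hC : C (m + 1) := ⟨by have := (hS t).1; omega, hne⟩
      rw [← Nat.nth_count hC] at hlt
      have h1 : Nat.count C (m + 1) < t + 1 := hmono.lt_iff_lt.1 hlt
      have h2 : S (Nat.count C (m + 1)) = m + 1 := Nat.nth_count hC
      have h3 := hmono.monotone (Nat.lt_succ_iff.1 h1)
      omega
  let q : ℕ → Finset (ι × ι) := fun t => pat α (S t - 1)
  have hq : ∀ t, q (t + 1) = pat α (S t) := fun t => by
    have := hmono (Nat.lt_succ_self t)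
    exact hconst t _ (by simp only [Nat.succ_eq_add_one] at this; omega) (by simp only [Nat.succ_eq_add_one] at this; omega)
  have hedge : ∀ t, RecEdge α (q t) (q (t + 1)) := fun t => by
    have h := (hS t).1
    have := hM (S t - 1) (by omega)
    rw [show S t - 1 + 1 = S t by omega, ← hq] at this
    exact this
  have hne : ∀ t, q (t + 1) ≠ q t := fun t => by
    rw [hq]; exact (hS t).2
  have hloc : ∀ m, S 0 ≤ m → ∃ t, S t ≤ m ∧ m < S (t + 1) := by
    intro m hm
    have hex : ∃ t, m < S t := ⟨m + 1, lt_of_lt_of_le (Nat.lt_succ_self m) hmono.le_apply⟩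
    have h1 := Nat.find_spec hex
    obtain ⟨t, ht⟩ : ∃ t, Nat.find hex = t + 1 := by
      refine Nat.exists_eq_succ_of_ne_zero fun h0 => ?_
      rw [h0] at h1
      omega
    refine ⟨t, ?_, ht ▸ h1⟩
    have := Nat.find_min hex (m := t) (by omega)
    omega
  have hrec : ∀ v ∈ recPats α, ∀ L, ∃ t, L ≤ t ∧ q t = v := by
    intro v hv L
    obtain ⟨m, hm, hmv⟩ := (mem_recPats α v).1 hv (S L)
    obtain ⟨t, h1, h2⟩ := hloc m ((hmono.monotone (Nat.zero_le L)).trans hm)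
    refine ⟨t + 1, ?_, by rw [hq, ← hmv, hconst t m h1 h2]⟩
    have := hmono.lt_iff_lt.1 (lt_of_le_of_lt hm h2)
    omega
  refine ⟨⟨S, q, fun t => by have := (hS t).1; omega, hmono, fun t m h1 h2 => ?_, fun t => rfl,
    ?_, hedge, fun v hv => ?_⟩⟩
  · rw [hconst t m h1 h2, hq]
  · rw [← hcard]
    refine fun t t' => periodic_of_deterministic q (recPats α) (fun t => (hedge t).left) hrec
      (fun t t' h => ?_) t t'
    have := PatSys.Extremal.deterministic hext (hedge t) (hedge t') (by rw [h])
      (by rw [PatSys.res_univ, PatSys.res_univ]; exact hne t)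
      (by rw [PatSys.res_univ, PatSys.res_univ, h]; exact hne t')
    rwa [PatSys.res_univ, PatSys.res_univ] at this
  · obtain ⟨t, -, h⟩ := hrec v hv 0
    exact ⟨t, h⟩

theorem count_univ {ι : Type*} [Fintype ι] [DecidableEq ι] (P : PatSys ι) :
    P.count Finset.univ = P.R.card := by
  unfold PatSys.count
  rw [Finset.card_image_of_injective]
  intro a b h
  rwa [PatSys.res_univ, PatSys.res_univ] at h

theorem card_recPats_eq {n k : ℕ} {α : Fin n → ℝ} (hn : n = k * (k + 1) / 2)
    (hα : ∀ i, Irrational (α i)) (hind : PairwiseIndependent α) (hka : kAlpha α = k) :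
    (recPats α).card = k := by
  have h1 := card_recPats_le hind
  have h2 := (patSys α hα hind.eventually).two_mul_card_le Finset.univ
  rw [count_univ, Finset.card_univ, Fintype.card_fin] at h2
  change 2 * n ≤ (recPats α).card * ((recPats α).card + 1) at h2
  have h3 : 2 * n = k * (k + 1) := by
    rw [hn]; exact Nat.mul_div_cancel' (Nat.even_mul_succ_self k).two_dvd
  rw [h3] at h2
  by_contra hne
  have h4 : (recPats α).card + 1 ≤ k := by omega
  have h5 : (recPats α).card * ((recPats α).card + 1) ≤ (recPats α).card * k :=
    Nat.mul_le_mul_left _ h4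
  have h6 : (recPats α).card * k < (k + 1) * k := by
    apply Nat.mul_lt_mul_of_pos_right <;> omega
  nlinarith

theorem extremal_univ {n k : ℕ} {α : Fin n → ℝ} (hn : n = k * (k + 1) / 2)
    (hα : ∀ i, Irrational (α i)) (hind : PairwiseIndependent α) (hka : kAlpha α = k) :
    (patSys α hα hind.eventually).Extremal Finset.univ := by
  unfold PatSys.Extremal
  rw [count_univ, Finset.card_univ, Fintype.card_fin]
  change 2 * n = (recPats α).card * ((recPats α).card + 1)
  rw [card_recPats_eq hn hα hind hka, hn]
  exact Nat.mul_div_cancel' (Nat.even_mul_succ_self k).two_dvd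

/-- Equality case of the double counting bound for `k` blocks of size `k` that meet pairwise in at
most one point, on a set of `k (k + 1) / 2` points. -/
theorem card_blocks_of_extremal {ι : Type*} [Fintype ι] [DecidableEq ι] {k : ℕ}
    {D : ℕ → Finset ι} (hn : 2 * Fintype.card ι = k * (k + 1)) (hD : ∀ c < k, (D c).card = k)
    (hI : ∀ c < k, ∀ c' < k, c ≠ c' → (D c ∩ D c').card ≤ 1) :
    (∀ f, ((Finset.range k).filter fun c => f ∈ D c).card = 1 ∨
      ((Finset.range k).filter fun c => f ∈ D c).card = 2) ∧
    ∀ c < k, ∀ c' < k, c ≠ c' → (D c ∩ D c').card = 1 := by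
  let T : ι → ℤ := fun f => ∑ c ∈ Finset.range k, if f ∈ D c then 1 else 0
  have hT : ∀ f, T f = (((Finset.range k).filter fun c => f ∈ D c).card : ℤ) := fun f => by
    simp [T]
  have h1 : ∑ f, T f = (k : ℤ) * k := by
    simp only [T]
    rw [Finset.sum_comm]
    have : ∀ c ∈ Finset.range k, ∑ f, (if f ∈ D c then (1 : ℤ) else 0) = k := fun c hc => by
      simp [hD c (Finset.mem_range.1 hc)]
    rw [Finset.sum_congr rfl this]
    simp
  let b : ℕ → ℕ → ℤ := fun c c' => if c = c' then k else 1
  have h2 : ∑ f, T f * T f =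
      ∑ c ∈ Finset.range k, ∑ c' ∈ Finset.range k, ((D c ∩ D c').card : ℤ) := by
    simp only [T, Finset.sum_mul_sum]
    rw [Finset.sum_comm]
    refine Finset.sum_congr rfl fun c _ => ?_
    rw [Finset.sum_comm]
    refine Finset.sum_congr rfl fun c' _ => ?_
    simp only [← ite_and, mul_ite, mul_one, mul_zero]
    rw [Finset.sum_boole]
    congr 2
    ext f
    simp [and_comm]
  have hb : ∑ c ∈ Finset.range k, ∑ c' ∈ Finset.range k, b c c' = 2 * (k : ℤ) * k - k := by
    have : ∀ c ∈ Finset.range k, ∑ c' ∈ Finset.range k, b c c' = 2 * (k : ℤ) - 1 := by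
      intro c hc
      have : ∀ c' ∈ Finset.range k, b c c' = 1 + if c = c' then (k : ℤ) - 1 else 0 := by
        intro c' _
        simp only [b]
        split_ifs <;> ring
      rw [Finset.sum_congr rfl this, Finset.sum_add_distrib, Finset.sum_ite_eq, if_pos hc]
      simp
      ring
    rw [Finset.sum_congr rfl this]
    simp
    ring
  have hle : ∀ c ∈ Finset.range k, ∀ c' ∈ Finset.range k, ((D c ∩ D c').card : ℤ) ≤ b c c' := by
    intro c hc c' hc'
    simp only [b]
    split_ifs with h
    · subst h
      simp [hD c (Finset.mem_range.1 hc)]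
    · exact_mod_cast hI c (Finset.mem_range.1 hc) c' (Finset.mem_range.1 hc') h
  have h3 : ∑ f, (T f - 1) * (T f - 2) = ∑ f, T f * T f - 3 * ∑ f, T f + 2 * Fintype.card ι := by
    rw [Finset.mul_sum, ← Finset.sum_sub_distrib]
    have : (2 * (Fintype.card ι : ℤ)) = ∑ _f : ι, 2 := by simp [mul_comm]
    rw [this, ← Finset.sum_add_distrib]
    exact Finset.sum_congr rfl fun f _ => by ring
  have hn' : (2 * (Fintype.card ι : ℤ)) = k * (k + 1) := by exact_mod_cast hn
  have h4 : ∑ c ∈ Finset.range k, ∑ c' ∈ Finset.range k, ((D c ∩ D c').card : ℤ) ≤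
      ∑ c ∈ Finset.range k, ∑ c' ∈ Finset.range k, b c c' :=
    Finset.sum_le_sum fun c hc => Finset.sum_le_sum fun c' hc' => hle c hc c' hc'
  have h5 : ∀ f ∈ Finset.univ, 0 ≤ (T f - 1) * (T f - 2) := fun f _ => by
    rcases le_or_gt (T f) 1 with h | h
    · exact mul_nonneg_of_nonpos_of_nonpos (by linarith) (by linarith)
    · exact mul_nonneg (by linarith) (by linarith [Int.add_one_le_iff.2 h])
  have h6 := Finset.sum_nonneg h5
  have h7 : ∑ f, (T f - 1) * (T f - 2) = 0 := by
    refine le_antisymm ?_ h6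
    rw [h3, h1, hn', h2]
    rw [hb] at h4
    linarith
  refine ⟨fun f => ?_, fun c hc c' hc' hne => ?_⟩
  · have := (Finset.sum_eq_zero_iff_of_nonneg h5).1 h7 f (Finset.mem_univ f)
    rw [hT] at this
    rcases mul_eq_zero.1 this with h | h
    · left; omega
    · right; omega
  · have h8 : ∑ c ∈ Finset.range k, ∑ c' ∈ Finset.range k, ((D c ∩ D c').card : ℤ) =
        ∑ c ∈ Finset.range k, ∑ c' ∈ Finset.range k, b c c' := by
      refine le_antisymm h4 ?_
      rw [hb, ← h2]
      rw [h7, h1, hn'] at h3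
      linarith
    have h9 := (Finset.sum_eq_sum_iff_of_le fun c hc => Finset.sum_le_sum fun c' hc' =>
      hle c hc c' hc').1 h8 c (Finset.mem_range.2 hc)
    have h10 := (Finset.sum_eq_sum_iff_of_le fun c' hc' => hle c (Finset.mem_range.2 hc) c' hc').1
      h9 c' (Finset.mem_range.2 hc')
    simp only [b, if_neg hne] at h10
    exact_mod_cast h10

theorem exists_mem_blocks_iff {ι : Type*} [Fintype ι] [DecidableEq ι] {k : ℕ}
    {D : ℕ → Finset ι} (hn : 2 * Fintype.card ι = k * (k + 1)) (hD : ∀ c < k, (D c).card = k)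
    (hI : ∀ c < k, ∀ c' < k, c ≠ c' → (D c ∩ D c').card ≤ 1) {a b : ℕ} (ha : a < k)
    (hb : b < k) : ∃ f, ∀ c < k, f ∈ D c ↔ c = a ∨ c = b := by
  obtain ⟨h1, h2⟩ := card_blocks_of_extremal hn hD hI
  rcases eq_or_ne a b with rfl | hab
  · have hlt : (((Finset.range k).erase a).biUnion fun c => D a ∩ D c).card < (D a).card := by
      refine lt_of_le_of_lt (Finset.card_biUnion_le_card_mul _ _ 1 fun c hc => ?_) ?_
      · rw [Finset.mem_erase, Finset.mem_range] at hc
        exact hI a ha c hc.2 hc.1.symm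
      · rw [Finset.card_erase_of_mem (Finset.mem_range.2 ha), Finset.card_range, hD a ha]
        omega
    obtain ⟨f, hf1, hf2⟩ := Finset.exists_mem_notMem_of_card_lt_card hlt
    refine ⟨f, fun c hc => ⟨fun h => ?_, fun h => ?_⟩⟩
    · by_contra hne
      rw [or_self] at hne
      exact hf2 (Finset.mem_biUnion.2 ⟨c, Finset.mem_erase.2 ⟨hne, Finset.mem_range.2 hc⟩,
        Finset.mem_inter.2 ⟨hf1, h⟩⟩)
    · rw [or_self] at h
      rwa [h]
  · obtain ⟨f, hf⟩ := Finset.card_eq_one.1 (h2 a ha b hb hab)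
    have hf' : f ∈ D a ∩ D b := hf ▸ Finset.mem_singleton_self f
    rw [Finset.mem_inter] at hf'
    have hsub : {a, b} ⊆ (Finset.range k).filter fun c => f ∈ D c := by
      intro c hc
      rw [Finset.mem_insert, Finset.mem_singleton] at hc
      rw [Finset.mem_filter, Finset.mem_range]
      rcases hc with rfl | rfl
      exacts [⟨ha, hf'.1⟩, ⟨hb, hf'.2⟩]
    have heq := Finset.eq_of_subset_of_card_le hsub (by
      rw [Finset.card_pair hab]
      rcases h1 f with h | h <;> omega)
    refine ⟨f, fun c hc => ?_⟩
    have := Finset.ext_iff.1 heq c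
    rw [Finset.mem_filter, Finset.mem_range, Finset.mem_insert, Finset.mem_singleton] at this
    rw [this]
    exact ⟨fun h => ⟨hc, h⟩, fun h => h.2⟩

theorem modEq_window {k a b : ℕ} (h : a ≡ b [MOD k]) (h1 : a < b + k) (h2 : b < a + k) :
    a = b :=
  h.eq_of_abs_lt (by rw [abs_lt]; constructor <;> omega)

namespace CyclicData

variable {ι : Type*} [Fintype ι] [DecidableEq ι] {α : ι → ℝ} {k N : ℕ} (c : CyclicData α k N)

/-- The functions that go down past another one at the `t`-th change. -/
def D (t : ℕ) : Finset ι := PatSys.down Finset.univ (c.q t) (c.q (t + 1))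

theorem mem_D {t : ℕ} {f : ι} :
    f ∈ c.D t ↔ ∃ g, (g, f) ∈ c.q t ∧ (f, g) ∈ c.q (t + 1) := by
  simp [D, PatSys.down]

theorem q_congr {t t' : ℕ} (h : t ≡ t' [MOD k]) : c.q t = c.q t' := (c.period t t').2 h

theorem D_congr {t t' : ℕ} (h : t ≡ t' [MOD k]) : c.D t = c.D t' := by
  unfold D
  rw [c.q_congr h, c.q_congr (h.add_right 1)]

theorem q_succ_ne (hk : 2 ≤ k) (t : ℕ) : c.q t ≠ c.q (t + 1) := fun h => by
  have := modEq_window ((c.period _ _).1 h) (by omega) (by omega)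
  omega

theorem q_mem (t : ℕ) : c.q t ∈ recPats α := (c.edge t).left

theorem q_S (t : ℕ) : pat α (c.S t) = c.q (t + 1) :=
  c.pat_eq t _ le_rfl (c.mono (Nat.lt_succ_self t))

section

variable {c} {hα : ∀ i, Irrational (α i)}
  {hd : ∃ M, ∀ m, M ≤ m → ∀ i j, i ≠ j → psiN (α i) m ≠ psiN (α j) m}

theorem card_D (hk : 2 ≤ k) (hext : (patSys α hα hd).Extremal Finset.univ)
    (hcard : (recPats α).card = k) (t : ℕ) : (c.D t).card = k := by
  have h := (hext.edge (show (patSys α hα hd).E _ _ from c.edge t) (by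
    rw [PatSys.res_univ, PatSys.res_univ]; exact c.q_succ_ne hk t)).1
  rw [count_univ] at h
  exact h.trans hcard

theorem exists_down (hk : 2 ≤ k) (hext : (patSys α hα hd).Extremal Finset.univ) {f g : ι}
    (hfg : f ≠ g) : ∃ t, (g, f) ∈ c.q t ∧ (f, g) ∈ c.q (t + 1) := by
  obtain ⟨v1, hv1, h1⟩ := (patSys α hα hd).flips g f hfg.symm
  obtain ⟨v2, hv2, h2⟩ := (patSys α hα hd).flips f g hfg
  obtain ⟨v, w, hE, hv, hw⟩ := (patSys α hα hd).connected (fun v => (g, f) ∈ v) ⟨v1, hv1, h1⟩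
    ⟨v2, hv2, ((patSys α hα hd).total _ hv2 f g hfg).1 h2⟩
  obtain ⟨t, rfl⟩ := c.surj v ((patSys α hα hd).memLeft _ _ hE)
  have hdet := hext.deterministic hE (show (patSys α hα hd).E _ _ from c.edge t) rfl
    (by
      rw [PatSys.res_univ, PatSys.res_univ]
      intro h
      rw [h] at hw
      exact hw hv)
    (by rw [PatSys.res_univ, PatSys.res_univ]; exact (c.q_succ_ne hk t).symm)
  rw [PatSys.res_univ, PatSys.res_univ] at hdet
  rw [hdet] at hw
  exact ⟨t, hv, ((patSys α hα hd).total _ (c.q_mem _) f g hfg).2 hw⟩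

theorem card_D_inter_le (hk : 2 ≤ k) (hext : (patSys α hα hd).Extremal Finset.univ)
    (hcard : (recPats α).card = k) {t t' : ℕ} (ht : ¬ t ≡ t' [MOD k]) :
    (c.D t ∩ c.D t').card ≤ 1 := by
  by_cases h2 : c.q t' = c.q (t + 1) ∧ c.q (t' + 1) = c.q t
  · have h3 : t' ≡ t + 1 [MOD k] := (c.period _ _).1 h2.1
    have h4 : t' + 1 ≡ t [MOD k] := (c.period _ _).1 h2.2
    have h5 : t + (1 + 1) ≡ t + 0 [MOD k] := ((h3.add_right 1).symm).trans h4
    have h6 := Nat.le_of_dvd (by norm_num)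
      ((Nat.modEq_zero_iff_dvd).1 (Nat.ModEq.add_left_cancel' t h5))
    obtain rfl : k = 2 := by omega
    by_contra hgt
    have e1 := card_D hk hext hcard (c := c) t
    have e2 := card_D hk hext hcard (c := c) t'
    have e3 : c.D t ∩ c.D t' = c.D t :=
      Finset.eq_of_subset_of_card_le Finset.inter_subset_left (by omega)
    have e4 : c.D t ∩ c.D t' = c.D t' :=
      Finset.eq_of_subset_of_card_le Finset.inter_subset_right (by omega)
    have e5 : 2 * Fintype.card ι = 2 * (2 + 1) := by
      unfold PatSys.Extremal at hext
      rw [count_univ, Finset.card_univ] at hext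
      change _ = (recPats α).card * ((recPats α).card + 1) at hext
      rwa [hcard] at hext
    obtain ⟨g, -, hg⟩ := Finset.exists_mem_notMem_of_card_lt_card
      (s := c.D t) (t := Finset.univ) (by rw [Finset.card_univ]; omega)
    obtain ⟨h, hh⟩ := Finset.card_pos.1 (by omega : 0 < (c.D t).card)
    have hne : g ≠ h := fun h' => hg (h' ▸ hh)
    obtain ⟨x, hx⟩ := exists_down (c := c) hk hext hne
    have hgx : g ∈ c.D x := c.mem_D.2 ⟨h, hx⟩
    have : x ≡ t [MOD 2] ∨ x ≡ t' [MOD 2] := by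
      unfold Nat.ModEq at ht ⊢
      omega
    rcases this with h7 | h7
    · rw [c.D_congr h7] at hgx
      exact hg hgx
    · rw [c.D_congr h7, ← e4, e3] at hgx
      exact hg hgx
  · refine hext.inter_card_le (show (patSys α hα hd).E _ _ from c.edge t)
      (show (patSys α hα hd).E _ _ from c.edge t') ?_ ?_ ?_ ?_ <;>
      simp only [PatSys.res_univ]
    · exact c.q_succ_ne hk t
    · exact c.q_succ_ne hk t'
    · rintro ⟨h, -⟩
      exact ht ((c.period _ _).1 h.symm)
    · exact h2

theorem exists_labels (hk : 2 ≤ k) (hext : (patSys α hα hd).Extremal Finset.univ)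
    (hcard : (recPats α).card = k) (a b : ℕ) :
    ∃ f, ∀ t, f ∈ c.D t ↔ t ≡ a [MOD k] ∨ t ≡ b [MOD k] := by
  have hn : 2 * Fintype.card ι = k * (k + 1) := by
    unfold PatSys.Extremal at hext
    rw [count_univ, Finset.card_univ] at hext
    change _ = (recPats α).card * ((recPats α).card + 1) at hext
    rwa [hcard] at hext
  obtain ⟨f, hf⟩ := exists_mem_blocks_iff (D := c.D) hn (fun t _ => card_D hk hext hcard t)
    (fun t ht t' ht' hne => card_D_inter_le hk hext hcard fun h =>
      hne (by unfold Nat.ModEq at h; rwa [Nat.mod_eq_of_lt ht, Nat.mod_eq_of_lt ht'] at h))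
    (Nat.mod_lt a (by omega)) (Nat.mod_lt b (by omega))
  refine ⟨f, fun t => ?_⟩
  rw [c.D_congr (Nat.mod_modEq t k).symm]
  exact hf _ (Nat.mod_lt t (by omega))

end

end CyclicData

/-- The times of change together with the functions indexed by pairs of residues, `x a b` being
the function that goes down exactly at the changes congruent to `a` or `b`. -/
structure LabelData {ι : Type*} [Fintype ι] (α : ι → ℝ) (k N : ℕ) where
  S : ℕ → ℕ
  x : ℕ → ℕ → ι
  bound : ∀ t, N < S t
  mono : StrictMono S
  pat_eq : ∀ t m, S t ≤ m → m < S (t + 1) → pat α m = pat α (S t)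
  pat_ne : ∀ t, pat α (S t) ≠ pat α (S t - 1)
  comm : ∀ a b, x a b = x b a
  congr : ∀ a b a' b', a ≡ a' [MOD k] → b ≡ b' [MOD k] → x a b = x a' b'
  cons : ∀ a b, a < b → b < a + k → ConsDen (α (x a b)) (S a) (S b)
  top : ∀ t i a b, t ≤ i → i ≤ a → a ≤ b → b < t + k → (a, b) ≠ (i, i) →
    psiN (α (x a b)) (S t - 1) < psiN (α (x i i)) (S t - 1)
  bot : ∀ t i j l, k ≤ t → t ≤ i → i ≤ j → j ≤ l → i < l → l < t + k →
    psiN (α (x l l)) (S t - 1) < psiN (α (x i j)) (S t - 1)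

theorem exists_labelData {ι : Type*} [Fintype ι] [DecidableEq ι] {α : ι → ℝ} {k : ℕ}
    (hk : 2 ≤ k) (hα : ∀ i, Irrational (α i))
    (hd : ∃ M, ∀ m, M ≤ m → ∀ i j, i ≠ j → psiN (α i) m ≠ psiN (α j) m)
    (hcard : (recPats α).card = k) (hext : (patSys α hα hd).Extremal Finset.univ) (N : ℕ) :
    Nonempty (LabelData α k N) := by
  obtain ⟨M, hM⟩ := id hd
  obtain ⟨c⟩ := exists_cyclicData hk hα hd hcard hext (N + M + 2)
  have hex : ∀ Q : ℕ → Prop, ∃ f, (∃ a b, ∀ t, Q t ↔ t ≡ a [MOD k] ∨ t ≡ b [MOD k]) →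
      ∀ t, f ∈ c.D t ↔ Q t := by
    intro Q
    by_cases h : ∃ a b, ∀ t, Q t ↔ t ≡ a [MOD k] ∨ t ≡ b [MOD k]
    · obtain ⟨a, b, hab⟩ := h
      obtain ⟨f, hf⟩ := CyclicData.exists_labels (c := c) hk hext hcard a b
      exact ⟨f, fun _ t => (hf t).trans (hab t).symm⟩
    · obtain ⟨f, -⟩ := CyclicData.exists_labels (c := c) hk hext hcard 0 0
      exact ⟨f, fun h' => absurd h' h⟩
  choose X hX using hex
  let x : ℕ → ℕ → ι := fun a b => X fun t => t ≡ a [MOD k] ∨ t ≡ b [MOD k]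
  have hx : ∀ a b t, x a b ∈ c.D t ↔ t ≡ a [MOD k] ∨ t ≡ b [MOD k] := fun a b t =>
    hX _ ⟨a, b, fun _ => Iff.rfl⟩ t
  have htot : ∀ t i j, i ≠ j → ((i, j) ∈ c.q t ↔ (j, i) ∉ c.q t) := fun t i j hij =>
    (patSys α hα hd).total _ (c.q_mem t) i j hij
  have hdiag : ∀ i g, g ≠ x i i → (g, x i i) ∈ c.q i ∧ (x i i, g) ∈ c.q (i + 1) := by
    intro i g hg
    obtain ⟨t, h1, h2⟩ := CyclicData.exists_down (c := c) hk hext hg.symm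
    have h3 := (hx i i t).1 (c.mem_D.2 ⟨g, h1, h2⟩)
    rw [or_self] at h3
    rw [c.q_congr h3] at h1
    rw [c.q_congr (h3.add_right 1)] at h2
    exact ⟨h1, h2⟩
  have hpers : ∀ f g t t', t ≤ t' → (∀ s, t ≤ s → s < t' → f ∉ c.D s) → (g, f) ∈ c.q t →
      (g, f) ∈ c.q t' := by
    intro f g t t' htt'
    induction t', htt' using Nat.le_induction with
    | base => exact fun _ h => h
    | succ t' ht' ih =>
      intro hD h
      have h1 := ih (fun s h1 h2 => hD s h1 (by omega)) h
      have hne : g ≠ f := by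
        rintro rfl
        exact (patSys α hα hd).irr _ (c.q_mem t') g h1
      rw [htot _ _ _ hne]
      exact fun h2 => hD t' ht' (by omega) (c.mem_D.2 ⟨g, h1, h2⟩)
  have hpq : ∀ t i j, (i, j) ∈ c.q t ↔ psiN (α i) (c.S t - 1) < psiN (α j) (c.S t - 1) := by
    intro t i j
    rw [← c.pat_pred, mem_pat]
  have hqS : ∀ t i j, (i, j) ∈ c.q (t + 1) ↔ psiN (α i) (c.S t) < psiN (α j) (c.S t) := by
    intro t i j
    rw [← c.q_S, mem_pat]
  have hden : ∀ f t, f ∈ c.D t → IsDen (α f) (c.S t) := by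
    intro f t h
    obtain ⟨g, h1, h2⟩ := c.mem_D.1 h
    rw [hpq] at h1
    rw [hqS] at h2
    have hb := c.bound t
    have h3 := psiN_anti (α g) (m := c.S t - 1) (m' := c.S t) (by omega) (by omega)
    have h4 := isDen_of_jump (α := α f) (s := c.S t - 1) (by omega) (by
      rw [show c.S t - 1 + 1 = c.S t by omega]
      linarith)
    rwa [show c.S t - 1 + 1 = c.S t by omega] at h4
  have hloc : ∀ a m, c.S a ≤ m → ∃ t, a ≤ t ∧ c.S t ≤ m ∧ m < c.S (t + 1) := by
    intro a m hm
    have hex : ∃ t, m < c.S t := ⟨m + 1, lt_of_lt_of_le (Nat.lt_succ_self m) c.mono.le_apply⟩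
    have h1 := Nat.find_spec hex
    have h0 : a < Nat.find hex := c.mono.lt_iff_lt.1 (lt_of_le_of_lt hm h1)
    obtain ⟨t, ht⟩ : ∃ t, Nat.find hex = t + 1 := Nat.exists_eq_succ_of_ne_zero (by omega)
    refine ⟨t, by omega, ?_, ht ▸ h1⟩
    have := Nat.find_min hex (m := t) (by omega)
    omega
  refine ⟨⟨c.S, x, fun t => by have := c.bound t; omega, c.mono, fun t m h1 h2 => ?_, fun t => ?_,
    fun a b => ?_, fun a b a' b' h1 h2 => ?_, ?_, ?_, ?_⟩⟩
  · rw [c.pat_eq t m h1 h2, c.q_S]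
  · rw [c.pat_pred, c.q_S]
    exact (c.q_succ_ne hk t).symm
  · simp only [x]
    congr 1
    funext t
    exact propext or_comm
  · simp only [x]
    congr 1
    funext t
    refine propext (or_congr ?_ ?_)
    · exact ⟨fun h => h.trans h1, fun h => h.trans h1.symm⟩
    · exact ⟨fun h => h.trans h2, fun h => h.trans h2.symm⟩
  · intro a b hab hbk
    have hfa : IsDen (α (x a b)) (c.S a) := hden _ _ ((hx a b a).2 (Or.inl rfl))
    have hfb : IsDen (α (x a b)) (c.S b) := hden _ _ ((hx a b b).2 (Or.inr rfl))
    have hdb : IsDen (α (x b b)) (c.S b) := hden _ _ ((hx b b b).2 (Or.inr rfl))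
    have hne : x a b ≠ x b b := fun h => by
      have h1 : x b b ∈ c.D a := h ▸ (hx a b a).2 (Or.inl rfl)
      have h2 := (hx b b a).1 h1
      rw [or_self] at h2
      have := modEq_window h2 (by omega) (by omega)
      omega
    have hSab := c.mono hab
    have hSa := c.bound a
    obtain ⟨r, hr⟩ := exists_predDen hfb (by omega)
    have har : c.S a ≤ r := by
      by_contra hlt
      obtain ⟨y, hy1, hy2⟩ := exists_succDen_le hr.1 hfa (by omega)
      have := hr.succ_unique hy1
      omega
    obtain ⟨t, h1, h2, h3⟩ := hloc a r har
    have hrb := hr.2.2.1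
    have htb : t < b := c.mono.lt_iff_lt.1 (lt_of_le_of_lt h2 hrb)
    obtain ⟨g1, g2⟩ := flip_at_pred (hα (x b b)) (hα (x a b)) (by omega) hr hdb
      ((hqS b _ _).1 (hdiag b _ hne).2) (hM _ (by omega) _ _ hne.symm)
      (hM _ (by omega) _ _ hne.symm)
    have hrt : r = c.S t := by
      by_contra hcon
      have h4 := c.pat_eq t r h2 h3
      have h5 := c.pat_eq t (r - 1) (by omega) (by omega)
      rw [← mem_pat, h5] at g1
      rw [← mem_pat, h4, htot _ _ _ hne] at g2
      exact g2 g1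
    rw [hrt] at g1 g2
    have hft : x a b ∈ c.D t := c.mem_D.2 ⟨x b b, (hpq _ _ _).2 g1, (hqS _ _ _).2 g2⟩
    obtain rfl : t = a := by
      rcases (hx a b t).1 hft with h | h
      · exact modEq_window h (by omega) (by omega)
      · have := modEq_window h (by omega) (by omega)
        omega
    rwa [hrt] at hr
  · intro t i a b h1 h2 h3 h4 h5
    have hne : x a b ≠ x i i := fun h => by
      have e : ∀ t, (t ≡ a [MOD k] ∨ t ≡ b [MOD k]) ↔ (t ≡ i [MOD k] ∨ t ≡ i [MOD k]) := by
        intro t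
        rw [← hx, ← hx, h]
      have e1 := (e a).1 (Or.inl rfl)
      have e2 := (e b).1 (Or.inr rfl)
      rw [or_self] at e1 e2
      have := modEq_window e1 (by omega) (by omega)
      have := modEq_window e2 (by omega) (by omega)
      apply h5
      simp [*]
    rw [← hpq, htot _ _ _ hne]
    intro h6
    have h7 := hpers (x a b) (x i i) t i h1 (fun s hs1 hs2 h => by
      rcases (hx a b s).1 h with h | h
      · have := modEq_window h (by omega) (by omega); omega
      · have := modEq_window h (by omega) (by omega); omega) h6
    exact (htot _ _ _ hne).1 (hdiag i _ hne).1 h7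
  · intro t i j l h1 h2 h3 h4 h5 h6
    have hne : x i j ≠ x l l := fun h => by
      have h7 : x l l ∈ c.D i := h ▸ (hx i j i).2 (Or.inl rfl)
      have h8 := (hx l l i).1 h7
      rw [or_self] at h8
      have := modEq_window h8 (by omega) (by omega)
      omega
    obtain ⟨u, rfl⟩ : ∃ u, l = u + k := ⟨l - k, by omega⟩
    have hl : c.q (u + k + 1) = c.q (u + 1) := c.q_congr (by
      unfold Nat.ModEq
      rw [show u + k + 1 = u + 1 + k by omega, Nat.add_mod_right])
    rw [← hpq]
    refine hpers _ _ (u + 1) t (by omega) (fun s hs1 hs2 h => ?_) (hl ▸ (hdiag (u + k) _ hne).2)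
    have hs : s + k ≡ s [MOD k] := by
      unfold Nat.ModEq
      rw [Nat.add_mod_right]
    rcases (hx i j s).1 h with h | h
    · have := modEq_window (hs.trans h) (by omega) (by omega); omega
    · have := modEq_window (hs.trans h) (by omega) (by omega); omega

namespace LabelData

variable {ι : Type*} [Fintype ι] {α : ι → ℝ} {k N : ℕ} (c : LabelData α k N)

theorem cons_shift {a b : ℕ} (hab : a < b) (hb : b < a + k) :
    ConsDen (α (c.x a b)) (c.S b) (c.S (a + k)) := by
  have h := c.cons b (a + k) hb (by omega)
  have : c.x b (a + k) = c.x a b := by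
    rw [c.comm a b]
    refine c.congr _ _ _ _ rfl ?_
    unfold Nat.ModEq
    rw [Nat.add_mod_right]
  rwa [this] at h

theorem growth (hα : ∀ i, Irrational (α i)) {a b b' : ℕ} (hab : a < b)
    (hbb : b < b') (hb : b' < a + k) : c.S a + c.S b * c.S b' ≤ c.S (a + k) := by
  have key : ∀ b, a < b → b < a + k → c.S b ∣ c.S (a + k) - c.S a := by
    intro b h1 h2
    obtain ⟨e, -, he, -⟩ := (c.cons a b h1 h2).recurrence (hα _) (c.cons_shift h1 h2)
    exact ⟨e, by rw [he, mul_comm]; omega⟩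
  have hco := (c.cons b b' hbb (by omega)).coprime (hα _)
  have hdvd := hco.mul_dvd_of_dvd_of_dvd (key b hab (by omega)) (key b' (by omega) hb)
  have hlt := c.mono (show a < a + k by omega)
  have := Nat.le_of_dvd (by omega) hdvd
  omega

theorem two_mul_le (hα : ∀ i, Irrational (α i)) (hN : 1 ≤ N) (hk : 3 ≤ k) {a b : ℕ}
    (hab : a < b) (hb : k ≤ b) : 2 * c.S a ≤ c.S b := by
  obtain ⟨e, rfl⟩ : ∃ e, b = e + k := ⟨b - k, by omega⟩
  have h1 := c.growth hα (a := e) (b := e + k - 2) (b' := e + k - 1) (by omega) (by omega)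
    (by omega)
  have h2 := c.bound (e + k - 2)
  have h3 := c.mono.monotone (show a ≤ e + k - 1 by omega)
  have h4 : 2 * c.S (e + k - 1) ≤ c.S (e + k - 2) * c.S (e + k - 1) :=
    Nat.mul_le_mul_right _ (by omega)
  omega

theorem psiN_eq {t i j : ℕ} (hij : i < j) (ht : t ≤ i) (htk : k ≤ t) (hj : j < t + k) :
    psiN (α (c.x i j)) (c.S t - 1) = psiN (α (c.x i j)) (c.S (j - k)) ∧
      ConsDen (α (c.x i j)) (c.S (j - k)) (c.S i) := by
  have h := c.cons (j - k) i (by omega) (by omega)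
  have e : c.x (j - k) i = c.x i j := by
    rw [c.comm i j]
    refine c.congr _ _ _ _ ?_ rfl
    conv_rhs => rw [show j = j - k + k by omega]
    unfold Nat.ModEq
    rw [Nat.add_mod_right]
  rw [e] at h
  have h1 := c.mono (show j - k < t by omega)
  have h2 := c.mono.monotone ht
  exact ⟨h.2.2.2 _ (by omega) (by omega), h⟩

theorem psiN_lt_of_left (hα : ∀ i, Irrational (α i)) (hN : 1 ≤ N) {t i j i' j' : ℕ} (htk : k ≤ t)
    (hti : t ≤ i) (hij : i < j) (hii : i < i') (hij' : i' < j') (hj : j < t + k)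
    (hj' : j' < t + k) :
    psiN (α (c.x i' j')) (c.S t - 1) < psiN (α (c.x i j)) (c.S t - 1) := by
  obtain ⟨e1, h1⟩ := c.psiN_eq hij hti htk hj
  obtain ⟨e2, h2⟩ := c.psiN_eq hij' (by omega) htk hj'
  rw [e1, e2]
  have d1 := (h1.det (hα _)).1
  have d2 := h2.mul_lt_one (hα _)
  have l1 := h1.2.1.2 _ h1.1.1 h1.2.2.1
  have g1 := c.two_mul_le hα hN (by omega) (show i' - 1 < i' by omega) (by omega)
  have g2 := c.mono.monotone (show i ≤ i' - 1 by omega)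
  have g3 := c.mono.monotone (show j - k ≤ i' - 1 by omega)
  have g4 : (c.S i : ℝ) + c.S (j - k) ≤ c.S i' := by
    have : c.S i + c.S (j - k) ≤ c.S i' := by omega
    exact_mod_cast this
  have g5 : (0 : ℝ) < c.S (j - k) := by
    have := c.bound (j - k)
    exact_mod_cast (by omega : 0 < c.S (j - k))
  have g6 : (0 : ℝ) < c.S i' := by
    have := c.bound i'
    exact_mod_cast (by omega : 0 < c.S i')
  have p1 := psiN_pos (hα (c.x i j)) h1.1.1
  have h3 : 1 < ((c.S i : ℝ) + c.S (j - k)) * psiN (α (c.x i j)) (c.S (j - k)) := by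
    nlinarith
  have h4 : 1 < (c.S i' : ℝ) * psiN (α (c.x i j)) (c.S (j - k)) := by nlinarith
  exact lt_of_mul_lt_mul_left (d2.trans h4) g6.le

theorem psiN_lt_of_right (hα : ∀ i, Irrational (α i)) (hN : 1 ≤ N) {t i j j' : ℕ} (htk : k ≤ t)
    (hti : t ≤ i) (hij : i < j') (hjj : j' < j) (hj : j < t + k) :
    psiN (α (c.x i j)) (c.S t - 1) > psiN (α (c.x i j')) (c.S t - 1) := by
  obtain ⟨e1, h1⟩ := c.psiN_eq (hij.trans hjj) hti htk hj
  obtain ⟨e2, h2⟩ := c.psiN_eq hij (by omega) htk (by omega)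
  rw [e1, e2]
  have d1 := (h1.det (hα _)).1
  have d2 := (h2.det (hα _)).1
  have c1 := c.cons i j (by omega) (by omega)
  have c2 := c.cons i j' (by omega) (by omega)
  have m1 := c1.mul_lt_one (hα _)
  have m2 := (c2.det (hα _)).1
  have l2 := c2.2.1.2 _ c2.1.1 c2.2.2.1
  obtain ⟨u, rfl⟩ : ∃ u, j = u + k := ⟨j - k, by omega⟩
  have g1 := c.growth hα (a := u) (b := i) (b' := j') (by omega) (by omega) (by omega)
  have g2 := c.two_mul_le hα hN (by omega) (show u < i by omega) (by omega)
  simp only [Nat.add_sub_cancel] at d1 h1 e1 ⊢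
  have g1' : (c.S i : ℝ) * c.S j' ≤ c.S (u + k) := by
    have : c.S i * c.S j' ≤ c.S (u + k) := by omega
    exact_mod_cast this
  have g2' : (2 : ℝ) * c.S u ≤ c.S i := by exact_mod_cast g2
  have hSu : (1 : ℝ) ≤ c.S u := by exact_mod_cast h1.1.1
  have hSi : (1 : ℝ) ≤ c.S i := by exact_mod_cast h1.2.1.1
  have hSv : (1 : ℝ) ≤ c.S (j' - k) := by exact_mod_cast h2.1.1
  have hij2 : (c.S i : ℝ) ≤ c.S j' := by exact_mod_cast c.mono.monotone hij.le
  set A : ℝ := ((c.S i : ℕ) : ℝ)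
  set B : ℝ := ((c.S j' : ℕ) : ℝ)
  set C : ℝ := ((c.S u : ℕ) : ℝ)
  set E : ℝ := ((c.S (j' - k) : ℕ) : ℝ)
  set F : ℝ := ((c.S (u + k) : ℕ) : ℝ)
  set f := psiN (α (c.x i (u + k)))
  set g := psiN (α (c.x i j'))
  have pf : 0 < f (c.S i) := psiN_pos (hα _) h1.2.1.1
  have pg : 0 < g (c.S i) := psiN_pos (hα _) h1.2.1.1
  have s1 : A * B * f (c.S i) < 1 := lt_of_le_of_lt (mul_le_mul_of_nonneg_right g1' pf.le) m1
  have s2 : 1 < (B + A) * g (c.S i) := by nlinarith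
  have s3 : C * (B + A) ≤ A * B := by nlinarith
  have s4 : C * (B + A) * f (c.S i) < 1 :=
    lt_of_le_of_lt (mul_le_mul_of_nonneg_right s3 pf.le) s1
  have s5 : (B + A) * (C * f (c.S i)) < (B + A) * (E * g (c.S i)) := by nlinarith
  have s6 := lt_of_mul_lt_mul_left s5 (by linarith)
  have s7 : A * g (c.S (j' - k)) < A * f (c.S u) := by linarith
  exact lt_of_mul_lt_mul_left s7 (by linarith)

/-- The order of the labelled functions before the `t`-th change. -/
theorem psiN_lt (hα : ∀ i, Irrational (α i)) (hN : 1 ≤ N) {t i j i' j' : ℕ} (htk : k ≤ t)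
    (hti : t ≤ i) (hij : i ≤ j) (hij' : i' ≤ j') (hj : j < t + k) (hj' : j' < t + k)
    (h : i < i' ∨ i = i' ∧ (i = j ∧ i' < j' ∨ i' < j' ∧ j' < j)) :
    psiN (α (c.x i' j')) (c.S t - 1) < psiN (α (c.x i j)) (c.S t - 1) := by
  rcases hij.eq_or_lt with rfl | hlt
  · refine c.top t i i' j' hti (by omega) hij' hj' fun h' => ?_
    rw [Prod.mk.injEq] at h'
    omega
  rcases h with h | ⟨rfl, h⟩
  · rcases hij'.eq_or_lt with rfl | hlt'
    · rcases le_or_gt j i' with hji | hji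
      · exact c.bot t i j i' htk hti hij hji h hj'
      · exact (c.bot t i i' i' htk hti h.le le_rfl h hj').trans
          (c.psiN_lt_of_right hα hN htk hti h hji hj)
    · exact c.psiN_lt_of_left hα hN htk hti hlt h hlt' hj hj'
  · rcases h with h | h
    · omega
    · exact c.psiN_lt_of_right hα hN htk hti h.1 h.2 hj

end LabelData

instance (k : ℕ) : Finite (PairIdx k) :=
  inferInstanceAs (Finite {p : Fin k × Fin k // p.1 ≤ p.2})

theorem rowStart_succ {k a : ℕ} (h : a < k) :
    (a + 1) * k - (a + 1) * (a + 1 - 1) / 2 = a * k - a * (a - 1) / 2 + (k - a) := by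
  have h1 := Nat.triangle_succ a
  have h2 : a * (a - 1) / 2 ≤ a * k :=
    (Nat.div_le_self _ _).trans (Nat.mul_le_mul_left _ (by omega))
  rw [h1, Nat.succ_mul]
  omega

theorem rowStart_le {k a b : ℕ} (hab : a < b) (hb : b < k) :
    a * k - a * (a - 1) / 2 + (k - a) ≤ b * k - b * (b - 1) / 2 := by
  induction b, (show a + 1 ≤ b from hab) using Nat.le_induction with
  | base => exact (rowStart_succ (by omega)).ge
  | succ b hab' ih =>
    rw [rowStart_succ (by omega)]
    exact (ih hab' (by omega)).trans (Nat.le_add_right _ _)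

theorem posIdx_lt_of_left {k : ℕ} {p q : PairIdx k} (h : p.1.1 < q.1.1) : posIdx p < posIdx q := by
  have h1 := rowStart_le (k := k) (a := p.1.1.val) (b := q.1.1.val) h q.1.1.isLt
  have h2 : p.1.1.val ≤ p.1.2.val := p.2
  have h3 := p.1.2.isLt
  unfold posIdx
  refine lt_of_lt_of_le ?_ (h1.trans (Nat.le_add_right _ _))
  split_ifs <;> omega

theorem posIdx_injective (k : ℕ) : Function.Injective (posIdx (k := k)) := by
  intro p q h
  rcases lt_trichotomy p.1.1 q.1.1 with h1 | h1 | h1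
  · exact absurd h (posIdx_lt_of_left h1).ne
  · refine Subtype.ext (Prod.ext h1 (Fin.ext ?_))
    have h2 := p.1.2.isLt
    have h3 := q.1.2.isLt
    unfold posIdx at h
    rw [h1] at h
    have h4 := Nat.add_left_cancel h
    split_ifs at h4 <;> omega
  · exact absurd h (posIdx_lt_of_left h1).ne'

theorem of_posIdx_lt {k : ℕ} {p q : PairIdx k} (h : posIdx p < posIdx q) :
    p.1.1.val < q.1.1.val ∨ p.1.1.val = q.1.1.val ∧
      (p.1.1.val = p.1.2.val ∧ q.1.1.val < q.1.2.val ∨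
        q.1.1.val < q.1.2.val ∧ q.1.2.val < p.1.2.val) := by
  rcases lt_trichotomy p.1.1 q.1.1 with h1 | h1 | h1
  · exact Or.inl h1
  · refine Or.inr ⟨congrArg Fin.val h1, ?_⟩
    have h2 : p.1.1.val ≤ p.1.2.val := p.2
    have h3 : q.1.1.val ≤ q.1.2.val := q.2
    unfold posIdx at h
    rw [h1] at h h2 ⊢
    have h4 := Nat.lt_of_add_lt_add_left h
    split_ifs at h4 <;> omega
  · exact absurd h (posIdx_lt_of_left h1).not_gt

theorem IsOrderVecP.unique {n k : ℕ} {α : Fin n → ℝ} {t : ℝ} {u v : PairIdx k → Fin n}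
    (hu : IsOrderVecP α t u) (hv : IsOrderVecP α t v) : u = v := by
  let _ : LinearOrder (PairIdx k) := LinearOrder.lift' posIdx (posIdx_injective k)
  have huA : StrictAnti fun p => psi (α (u p)) t := fun p q h => hu.2 p q h
  have hvA : StrictAnti fun p => psi (α (v p)) t := fun p q h => hv.2 p q h
  let σ : PairIdx k ≃ PairIdx k :=
    (Equiv.ofBijective u hu.1).trans (Equiv.ofBijective v hv.1).symm
  have hσ : ∀ p, v (σ p) = u p := fun p =>
    (Equiv.ofBijective v hv.1).apply_symm_apply (u p)
  let e : PairIdx k ≃o PairIdx k := ⟨σ, fun {a b} => by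
    have h1 := huA.le_iff_ge (a := b) (b := a)
    have h2 := hvA.le_iff_ge (a := σ b) (b := σ a)
    simp only [hσ] at h2
    exact h2.symm.trans h1⟩
  have he : e = OrderIso.refl _ := Subsingleton.elim _ _
  funext p
  have : σ p = p := congrArg (fun f : PairIdx k ≃o PairIdx k => f p) he
  rw [← hσ, this]

theorem pat_eq_pat_iff {n : ℕ} (α : Fin n → ℝ) {t t' : ℝ} (ht : 0 ≤ t) (ht' : 0 ≤ t') :
    pat α ⌊t⌋₊ = pat α ⌊t'⌋₊ ↔ SameOrder α t t' := by
  rw [Finset.ext_iff, Prod.forall]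
  simp only [mem_pat, ← psi_eq_floor _ ht, ← psi_eq_floor _ ht']
  rfl

theorem IsOrderVecP.of_sameOrder {n k : ℕ} {α : Fin n → ℝ} {t t' : ℝ} {v : PairIdx k → Fin n}
    (h : IsOrderVecP α t v) (hs : SameOrder α t t') : IsOrderVecP α t' v :=
  ⟨h.1, fun p q hpq => (hs _ _).1 (h.2 p q hpq)⟩

namespace LabelData

variable {n k N : ℕ} {α : Fin n → ℝ} (c : LabelData α k N)

/-- The order vector before the `t`-th change. -/
def vec (t : ℕ) (p : PairIdx k) : Fin n := c.x (t + p.1.1.val) (t + p.1.2.val)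

theorem piMap_vec (t : ℕ) : piMap (c.vec t) = c.vec (t + 1) := by
  funext p
  have h1 := p.1.2.isLt
  have h2 : p.1.1.val ≤ p.1.2.val := p.2
  have hmod : ∀ a, t + 1 + (k - 1) + a ≡ t + a [MOD k] := fun a => by
    rw [show t + 1 + (k - 1) + a = t + a + k by omega]
    unfold Nat.ModEq
    rw [Nat.add_mod_right]
  change c.x (t + (tau p).1.1.val) (t + (tau p).1.2.val) =
    c.x (t + 1 + p.1.1.val) (t + 1 + p.1.2.val)
  by_cases h3 : p.1.2.val = k - 1
  · by_cases h4 : p.1.1.val = k - 1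
    · have e : tau p = mkPos 0 0 le_rfl (by omega) := (dif_pos h3).trans (dif_pos h4)
      rw [e, h3, h4]
      exact c.congr _ _ _ _ (hmod 0).symm (hmod 0).symm
    · have e : tau p = mkPos 0 (p.1.1.val + 1) (Nat.zero_le _) (by omega) :=
        (dif_pos h3).trans (dif_neg h4)
      rw [e, h3, c.comm, show t + 1 + p.1.1.val = t + (p.1.1.val + 1) by omega]
      exact c.congr _ _ _ _ rfl (hmod 0).symm
  · have e : tau p = mkPos (p.1.1.val + 1) (p.1.2.val + 1) (by omega) (by omega) :=
      dif_neg h3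
    rw [e, show t + 1 + p.1.1.val = t + (p.1.1.val + 1) by omega,
      show t + 1 + p.1.2.val = t + (p.1.2.val + 1) by omega]
    rfl

theorem isOrderVecP_vec (hα : ∀ i, Irrational (α i)) (hN : 1 ≤ N) {t : ℕ} (htk : k ≤ t)
    {v : PairIdx k → Fin n} (hv : Function.Bijective v) :
    IsOrderVecP α (c.S t - 1 : ℕ) (c.vec t) := by
  have h : ∀ p q : PairIdx k, posIdx p < posIdx q →
      psiN (α (c.vec t q)) (c.S t - 1) < psiN (α (c.vec t p)) (c.S t - 1) := by
    intro p q hpq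
    have h1 := of_posIdx_lt hpq
    have h2 : p.1.1.val ≤ p.1.2.val := p.2
    have h3 : q.1.1.val ≤ q.1.2.val := q.2
    have h4 := p.1.2.isLt
    have h5 := q.1.2.isLt
    exact c.psiN_lt hα hN htk (by omega) (by omega) (by omega) (by omega) (by omega) (by omega)
  have hinj : Function.Injective (c.vec t) := by
    intro p q hpq
    by_contra hne
    rcases lt_or_gt_of_ne ((posIdx_injective k).ne hne) with h1 | h1
    · have := h _ _ h1
      rw [hpq] at this
      exact lt_irrefl _ this
    · have := h _ _ h1
      rw [hpq] at this
      exact lt_irrefl _ this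
  refine ⟨⟨hinj, ?_⟩, h⟩
  let e := Equiv.ofBijective v hv
  have h1 : Function.Surjective (c.vec t ∘ e.symm) :=
    Finite.surjective_of_injective (hinj.comp e.symm.injective)
  exact h1.of_comp

theorem exists_between {b : ℕ} {m : ℕ} (hm : c.S b ≤ m) :
    ∃ t, b ≤ t ∧ c.S t ≤ m ∧ m < c.S (t + 1) := by
  have hex : ∃ t, m < c.S t := ⟨m + 1, lt_of_lt_of_le (Nat.lt_succ_self m) c.mono.le_apply⟩
  have h1 := Nat.find_spec hex
  have h0 : b < Nat.find hex := c.mono.lt_iff_lt.1 (lt_of_le_of_lt hm h1)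
  obtain ⟨t, ht⟩ : ∃ t, Nat.find hex = t + 1 := Nat.exists_eq_succ_of_ne_zero (by omega)
  refine ⟨t, by omega, ?_, ht ▸ h1⟩
  have := Nat.find_min hex (m := t) (by omega)
  omega

theorem sameOrder {t : ℕ} {s s' : ℝ} (h1 : c.S t ≤ s) (h2 : s < c.S (t + 1)) (h1' : c.S t ≤ s')
    (h2' : s' < c.S (t + 1)) : SameOrder α s s' := by
  have h0 : (0 : ℝ) ≤ c.S t := Nat.cast_nonneg _
  rw [← pat_eq_pat_iff α (h0.trans h1) (h0.trans h1'),
    c.pat_eq t _ (Nat.le_floor h1) ((Nat.floor_lt (h0.trans h1)).2 h2),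
    c.pat_eq t _ (Nat.le_floor h1') ((Nat.floor_lt (h0.trans h1')).2 h2')]

theorem isLeast_change {t : ℕ} {s : ℝ} (h1 : c.S t ≤ s) (h2 : s < c.S (t + 1)) :
    IsLeast {s' : ℝ | s < s' ∧ ¬ SameOrder α s s'} (c.S (t + 1)) := by
  have h0 : (0 : ℝ) ≤ c.S t := Nat.cast_nonneg _
  have hlt := c.mono (Nat.lt_succ_self t)
  rw [Nat.succ_eq_add_one] at hlt
  refine ⟨⟨h2, fun h => c.pat_ne (t + 1) ?_⟩, fun s' hs' => ?_⟩
  · rw [← pat_eq_pat_iff α (h0.trans h1) (Nat.cast_nonneg _), Nat.floor_natCast,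
      c.pat_eq t _ (Nat.le_floor h1) ((Nat.floor_lt (h0.trans h1)).2 h2)] at h
    rw [← h, c.pat_eq t (c.S (t + 1) - 1) (by omega) (by omega)]
  · by_contra hlt'
    rw [not_le] at hlt'
    exact hs'.2 (c.sameOrder h1 h2 (h1.trans hs'.1.le) hlt')

theorem isOrderVecP_piMap (hα : ∀ i, Irrational (α i)) (hN : 1 ≤ N) {t : ℕ} (htk : k ≤ t)
    {s : ℝ} (h1 : c.S t ≤ s) (h2 : s < c.S (t + 1)) {v : PairIdx k → Fin n}
    (hv : IsOrderVecP α s v) : IsOrderVecP α (c.S (t + 1)) (piMap v) := by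
  have hpred : ∀ t, (c.S t : ℝ) ≤ (c.S (t + 1) - 1 : ℕ) ∧
      ((c.S (t + 1) - 1 : ℕ) : ℝ) < c.S (t + 1) := by
    intro t
    have h := c.mono (Nat.lt_succ_self t)
    rw [Nat.succ_eq_add_one] at h
    exact ⟨by exact_mod_cast (by omega : c.S t ≤ c.S (t + 1) - 1),
      by exact_mod_cast (by omega : c.S (t + 1) - 1 < c.S (t + 1))⟩
  have e1 := hv.of_sameOrder (c.sameOrder h1 h2 (hpred t).1 (hpred t).2)
  rw [e1.unique (c.isOrderVecP_vec hα hN (by omega) hv.1), piMap_vec]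
  refine (c.isOrderVecP_vec hα hN (t := t + 1 + 1) (by omega) hv.1).of_sameOrder ?_
  exact c.sameOrder (hpred _).1 (hpred _).2 le_rfl
    (by exact_mod_cast c.mono (Nat.lt_succ_self (t + 1)))

end LabelData

/-- **Main theorem.** In the extremal case `n = k(k+1)/2`, `k(α) = k`, consecutive order
vectors at the moments of permutation changes are related by the permutation `π`. -/
theorem stmt3 (k : ℕ) (hk : 2 ≤ k) (n : ℕ) (hn : n = k * (k + 1) / 2)
    (α : Fin n → ℝ) (hirr : ∀ i, Irrational (α i)) (hind : PairwiseIndependent α)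
    (hka : kAlpha α = k) :
    ∃ T : ℝ, 1 < T ∧ ∀ t0 : ℝ, T ≤ t0 → ∀ ts : ℕ → ℝ, ts 0 = t0 → IsChangeSeq α ts →
      ∀ i : ℕ, ∀ v : PairIdx k → Fin n,
        IsOrderVecP α (ts i) v → IsOrderVecP α (ts (i + 1)) (piMap v) := by
  obtain ⟨c⟩ := exists_labelData hk hirr hind.eventually
    (card_recPats_eq hn hirr hind hka) (extremal_univ hn hirr hind hka) 1
  refine ⟨c.S k, by exact_mod_cast c.bound k, fun t0 ht0 ts hts hch i v hv => ?_⟩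
  have hge : (c.S k : ℝ) ≤ ts i := by
    clear hv
    induction i with
    | zero => rwa [hts]
    | succ i ih => exact ih.trans (hch i).1.1.le
  have h0 : (0 : ℝ) ≤ ts i := (Nat.cast_nonneg _).trans hge
  obtain ⟨t, h1, h2, h3⟩ := c.exists_between (Nat.le_floor hge)
  have h2' : (c.S t : ℝ) ≤ ts i := (Nat.le_floor_iff h0).1 h2
  have h3' : ts i < c.S (t + 1) := (Nat.floor_lt h0).1 h3
  rw [(hch i).unique (c.isLeast_change h2' h3')]
  exact c.isOrderVecP_piMap hirr le_rfl h1 h2' h3' hv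
end

section
/- Let α and β be irrational numbers such that neither α + β nor α − β is an integer, with continued fraction convergent denominators (q_m) and (h_s) respectively. Then there exists T > 0 such that for all indices m, s and all integers d ≥ 1 with q_m > T and h_s > T: if q_{m+1} = h_{s+d}, h_{s−1} ≤ q_m < h_s, and ψ_α(q_{m+1} − 1) < ψ_β(q_{m+1} − 1), then ψ_α(q_m − 1) > ψ_β(q_m − 1). -/
/-- The data of an infinite continued fraction expansion of `α`: `a n` is the partial quotient
of index `n + 1`, `p n / q n` is the `n`-th convergent, and `δ n = |q n * α - p n|`. -/
structure IsCFExpansion (α : ℝ) (a q p : ℕ → ℤ) (δ : ℕ → ℝ) : Prop where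
  one_le_a : ∀ n, 1 ≤ a n
  q_zero : q 0 = 1
  q_one : q 1 = a 0
  q_rec : ∀ n, q (n + 2) = a (n + 1) * q (n + 1) + q n
  p_one : p 1 = a 0 * p 0 + 1
  p_rec : ∀ n, p (n + 2) = a (n + 1) * p (n + 1) + p n
  δ_pos : ∀ n, 0 < δ n
  δ_zero : 1 = a 0 * δ 0 + δ 1
  δ_rec : ∀ n, δ n = a (n + 1) * δ (n + 1) + δ (n + 2)
  sub_zero : α - p 0 = δ 0

/-- The `n`-th complete quotient of the continued fraction of `α`. -/
noncomputable def completeQuotient (α : ℝ) : ℕ → ℝ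
  | 0 => α
  | n + 1 => (Int.fract (completeQuotient α n))⁻¹

/-- The sequence with initial values `u`, `v` and the continuant recurrence given by `a`. -/
def continuantSeq (a : ℕ → ℤ) (u v : ℤ) : ℕ → ℤ
  | 0 => u
  | 1 => v
  | n + 2 => a (n + 1) * continuantSeq a u v (n + 1) + continuantSeq a u v n

lemma irrational_completeQuotient {α : ℝ} (hα : Irrational α) (n : ℕ) :
    Irrational (completeQuotient α n) := by
  induction n with
  | zero => exact hα
  | succ n ih => exact (ih.sub_intCast ⌊completeQuotient α n⌋).inv

lemma fract_pos_of_irrational {x : ℝ} (hx : Irrational x) : 0 < Int.fract x :=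
  Int.fract_pos.2 (hx.ne_int _)

lemma one_le_floor_completeQuotient_succ {α : ℝ} (hα : Irrational α) (n : ℕ) :
    1 ≤ ⌊completeQuotient α (n + 1)⌋ := by
  rw [Int.le_floor]
  simpa [completeQuotient] using
    (one_le_inv₀ (fract_pos_of_irrational (irrational_completeQuotient hα n))).2
      (Int.fract_lt_one _).le

lemma stream_eq_completeQuotient {α : ℝ} (hα : Irrational α) (n : ℕ) :
    GenContFract.IntFractPair.stream α n =
      some (GenContFract.IntFractPair.of (completeQuotient α n)) := by
  induction n with
  | zero => rfl
  | succ n ih =>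
    exact GenContFract.IntFractPair.stream_succ_of_some ih
      (fract_pos_of_irrational (irrational_completeQuotient hα n)).ne'

lemma cfDen_eq_continuantSeq {α : ℝ} (hα : Irrational α) (n : ℕ) :
    cfDen α n = continuantSeq (fun n => ⌊completeQuotient α (n + 1)⌋) 1
      ⌊completeQuotient α 1⌋ n := by
  have hs (n : ℕ) : (GenContFract.of α).s.get? n = some ⟨1, ⌊completeQuotient α (n + 1)⌋⟩ :=
    GenContFract.get?_of_eq_some_of_succ_get?_intFractPair_stream
      (stream_eq_completeQuotient hα (n + 1))
  induction n using Nat.twoStepInduction with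
  | zero => simp [cfDen, continuantSeq]
  | one => simp [cfDen, continuantSeq, GenContFract.first_den_eq (hs 0)]
  | more n ih₁ ih₂ =>
    rw [cfDen, GenContFract.dens_recurrence (hs (n + 1)) ih₁ ih₂]
    simp [continuantSeq]

lemma exists_isCFExpansion {α : ℝ} (hα : Irrational α) :
    ∃ a q p δ, IsCFExpansion α a q p δ ∧ ∀ n, cfDen α n = q n := by
  have hmul (n : ℕ) : Int.fract (completeQuotient α n) *
      (⌊completeQuotient α (n + 1)⌋ + Int.fract (completeQuotient α (n + 1))) = 1 := by
    rw [Int.floor_add_fract]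
    exact mul_inv_cancel₀ (fract_pos_of_irrational (irrational_completeQuotient hα n)).ne'
  refine ⟨fun n => ⌊completeQuotient α (n + 1)⌋,
    continuantSeq (fun n => ⌊completeQuotient α (n + 1)⌋) 1 ⌊completeQuotient α 1⌋,
    continuantSeq (fun n => ⌊completeQuotient α (n + 1)⌋) ⌊α⌋ (⌊completeQuotient α 1⌋ * ⌊α⌋ + 1),
    fun n => ∏ i ∈ Finset.range (n + 1), Int.fract (completeQuotient α i),
    ⟨one_le_floor_completeQuotient_succ hα, rfl, rfl, fun _ => rfl, rfl, fun _ => rfl,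
      fun n => Finset.prod_pos fun i _ =>
        fract_pos_of_irrational (irrational_completeQuotient hα i), ?_, fun n => ?_, ?_⟩,
    cfDen_eq_continuantSeq hα⟩
  · simp only [Finset.prod_range_succ, Finset.prod_range_zero]
    linear_combination -hmul 0
  · simp only [Finset.prod_range_succ]
    linear_combination -(∏ i ∈ Finset.range n, Int.fract (completeQuotient α i)) *
      Int.fract (completeQuotient α n) * hmul (n + 1)
  · simp [continuantSeq, completeQuotient]

namespace IsCFExpansion

variable {α : ℝ} {a q p : ℕ → ℤ} {δ : ℕ → ℝ}

lemma one_le_q (h : IsCFExpansion α a q p δ) (n : ℕ) : 1 ≤ q n := by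
  induction n using Nat.twoStepInduction with
  | zero => exact h.q_zero.ge
  | one => exact h.q_one ▸ h.one_le_a 0
  | more n ih₁ ih₂ =>
    rw [h.q_rec]
    nlinarith [h.one_le_a (n + 1)]

lemma monotone_q (h : IsCFExpansion α a q p δ) : Monotone q := by
  refine monotone_nat_of_le_succ fun n => ?_
  cases n with
  | zero => exact h.q_zero ▸ h.one_le_q 1
  | succ n =>
    rw [h.q_rec]
    nlinarith [h.one_le_a (n + 1), h.one_le_q n, h.one_le_q (n + 1)]

lemma q_lt_q_succ (h : IsCFExpansion α a q p δ) {n : ℕ} (hn : 1 < q (n + 1)) :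
    q n < q (n + 1) := by
  cases n with
  | zero => exact h.q_zero ▸ hn
  | succ n =>
    rw [h.q_rec]
    nlinarith [h.one_le_a (n + 1), h.one_le_q n, h.one_le_q (n + 1)]

lemma q_mul_sub_p (h : IsCFExpansion α a q p δ) (n : ℕ) : q n * α - p n = (-1) ^ n * δ n := by
  induction n using Nat.twoStepInduction with
  | zero => simp [h.q_zero, h.sub_zero]
  | one =>
    rw [h.q_one, h.p_one]
    push_cast
    linear_combination (a 0 : ℝ) * h.sub_zero - h.δ_zero
  | more n ih₁ ih₂ =>
    rw [h.q_rec, h.p_rec]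
    push_cast
    linear_combination (a (n + 1) : ℝ) * ih₂ + ih₁ + (-1) ^ n * h.δ_rec n

lemma q_mul_δ_add (h : IsCFExpansion α a q p δ) (n : ℕ) :
    q (n + 1) * δ n + q n * δ (n + 1) = 1 := by
  induction n with
  | zero =>
    rw [h.q_one, h.q_zero]
    push_cast
    linear_combination -h.δ_zero
  | succ n ih =>
    rw [h.q_rec]
    push_cast
    linear_combination ih - (q (n + 1) : ℝ) * h.δ_rec n

lemma determinant (h : IsCFExpansion α a q p δ) (n : ℕ) :
    p (n + 1) * q n - p n * q (n + 1) = (-1) ^ n := by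
  induction n with
  | zero =>
    rw [h.q_one, h.q_zero, h.p_one]
    ring
  | succ n ih =>
    rw [h.q_rec, h.p_rec]
    linear_combination -ih

/-- Convergents are best approximations of the second kind. -/
lemma δ_le_abs_sub (h : IsCFExpansion α a q p δ) {n : ℕ} {k : ℤ} (hk : 1 ≤ k)
    (hkq : k < q (n + 1)) (l : ℤ) : δ n ≤ |k * α - l| := by
  obtain ⟨ε, hε, hε'⟩ : ∃ ε : ℤ, ε * ε = 1 ∧ ε = (-1) ^ n :=
    ⟨(-1) ^ n, by rw [← mul_pow]; simp, rfl⟩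
  have hdet := h.determinant n
  rw [← hε'] at hdet
  set x := ε * (k * p (n + 1) - l * q (n + 1)) with hx
  set y := ε * (l * q n - k * p n) with hy
  have hkxy : k = x * q n + y * q (n + 1) := by
    rw [hx, hy]
    linear_combination -k * ε * hdet - k * hε
  have hlxy : l = x * p n + y * p (n + 1) := by
    rw [hx, hy]
    linear_combination -l * ε * hdet - l * hε
  have hq := h.one_le_q n
  have hq' := h.one_le_q (n + 1)
  have hval : k * α - l = (-1) ^ n * (x * δ n - y * δ (n + 1)) := by
    rw [hkxy, hlxy]
    push_cast
    linear_combination (x : ℝ) * h.q_mul_sub_p n + (y : ℝ) * h.q_mul_sub_p (n + 1)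
  rw [hval, abs_mul, abs_pow, abs_neg, abs_one, one_pow, one_mul]
  have hδ := h.δ_pos n
  have hδ' := h.δ_pos (n + 1)
  rcases lt_or_ge 0 y with hypos | hynonpos
  · have hx1 : x ≤ -1 := by nlinarith
    have hx1' : (x : ℝ) ≤ -1 := by exact_mod_cast hx1
    have hy' : (0 : ℝ) < y := by exact_mod_cast hypos
    rw [abs_of_nonpos (by nlinarith)]
    nlinarith
  · have hx1 : 1 ≤ x := by nlinarith
    have hx1' : (1 : ℝ) ≤ x := by exact_mod_cast hx1
    have hy' : (y : ℝ) ≤ 0 := by exact_mod_cast hynonpos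
    rw [abs_of_nonneg (by nlinarith)]
    nlinarith

lemma psi_intCast_sub_one (h : IsCFExpansion α a q p δ) {n : ℕ} {k : ℤ} (hk : q n < k)
    (hkq : k ≤ q (n + 1)) : psi α ((k : ℝ) - 1) = δ n := by
  have hq := h.one_le_q n
  refine IsLeast.csInf_eq ⟨⟨q n, ⟨hq, ?_⟩, le_antisymm ?_ ?_⟩, ?_⟩
  · exact_mod_cast Int.le_sub_one_of_lt hk
  · refine (round_le _ (p n)).trans ?_
    rw [h.q_mul_sub_p, abs_mul, abs_pow, abs_neg, abs_one, one_pow, one_mul,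
      abs_of_pos (h.δ_pos n)]
  · exact h.δ_le_abs_sub hq (by lia) _
  · rintro _ ⟨l, ⟨hl, hlk⟩, rfl⟩
    have hlk' : l ≤ k - 1 := by exact_mod_cast hlk
    exact h.δ_le_abs_sub hl (by lia) _

lemma exists_q_eq_and_abs_eq (h : IsCFExpansion α a q p δ) (k j : ℕ) :
    ∃ e f : ℤ, 1 ≤ e ∧ 0 ≤ f ∧ (1 ≤ k → 1 ≤ f) ∧ q (j + 1 + k) = e * q (j + 1) + f * q j ∧
      |f * δ j - e * δ (j + 1)| = δ (j + 1 + k) := by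
  induction k generalizing j with
  | zero => exact ⟨1, 0, le_rfl, le_rfl, by simp, by simp, by simp [abs_of_pos (h.δ_pos _)]⟩
  | succ k ih =>
    obtain ⟨e, f, he, hf, -, hq, hδ⟩ := ih (j + 1)
    have ha := h.one_le_a (j + 1)
    refine ⟨e * a (j + 1) + f, e, by nlinarith, by lia, fun _ => he, ?_, ?_⟩
    · rw [show j + 1 + (k + 1) = j + 1 + 1 + k by ring, hq, h.q_rec]
      ring
    · rw [show j + 1 + (k + 1) = j + 1 + 1 + k by ring, ← hδ, h.δ_rec j, ← abs_neg]
      push_cast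
      ring_nf

/-- If a denominator `q (m + 2)` of `α` is a denominator of `β` with index larger than `j + 1`, and
`q (m + 1)` lies between the denominators of `β` of indices `j` and `j + 1`, then the order of the
approximation errors before `q (m + 2)` is reversed before `q (m + 1)`. -/
lemma lt_of_lt_of_q_eq (hα : IsCFExpansion α a q p δ) {β : ℝ} {b r s : ℕ → ℤ} {η : ℕ → ℝ}
    (hβ : IsCFExpansion β b r s η) {m j k : ℕ} (hQ : q (m + 2) = r (j + 2 + k))
    (hj : r j < q (m + 1)) (hj' : q (m + 1) ≤ r (j + 1))
    (hk : q (m + 1) ≤ r (j + 1 + k)) (hlt : δ (m + 1) < η (j + 1 + k)) :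
    η j < δ m := by
  obtain ⟨e, f, he, -, hf, hr, habs⟩ := hβ.exists_q_eq_and_abs_eq (k + 1) j
  have hf := hf (by lia)
  rw [show j + 1 + (k + 1) = j + 2 + k by ring] at hr habs
  have hα1 := hα.q_mul_δ_add (m + 1)
  have hβ1 := hβ.q_mul_δ_add (j + 1 + k)
  rw [show j + 1 + k + 1 = j + 2 + k by ring, ← hQ] at hβ1
  have hηD := hβ.δ_pos (j + 2 + k)
  have hq0 := hα.one_le_q m
  have hq1 := hα.one_le_q (m + 1)
  have hq2 := hα.one_le_q (m + 2)
  have hr0 := hβ.one_le_q j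
  have hqR : (1 : ℝ) ≤ q (m + 1) := by exact_mod_cast hq1
  have hq0R : (1 : ℝ) ≤ q m := by exact_mod_cast hq0
  have hQR : (1 : ℝ) ≤ q (m + 2) := by exact_mod_cast hq2
  have hr0R : (1 : ℝ) ≤ r j := by exact_mod_cast hr0
  have hkR : (q (m + 1) : ℝ) ≤ r (j + 1 + k) := by exact_mod_cast hk
  have hjR : (r j : ℝ) < q (m + 1) := by exact_mod_cast hj
  have hδη : η (j + 2 + k) < δ (m + 2) := by
    have h1 : (q (m + 2) : ℝ) * δ (m + 1) < q (m + 2) * η (j + 1 + k) := by gcongr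
    have h2 : (q (m + 1) : ℝ) * η (j + 2 + k) ≤ r (j + 1 + k) * η (j + 2 + k) := by gcongr
    refine lt_of_mul_lt_mul_left (a := (q (m + 1) : ℝ)) ?_ (by linarith)
    linarith
  have hsmall : (r j : ℝ) * η (j + 2 + k) < 1 := by
    have h1 : (r j : ℝ) * η (j + 2 + k) ≤ r (j + 1 + k) * η (j + 2 + k) := by
      gcongr
      linarith
    have h2 : (0 : ℝ) < q (m + 2) * η (j + 1 + k) :=
      mul_pos (by linarith) (hβ.δ_pos _)
    linarith
  have hδm : (q (m + 2) : ℝ) * δ m = a (m + 1) + q m * δ (m + 2) := by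
    have hrec : (q (m + 2) : ℝ) = a (m + 1) * q (m + 1) + q m := by exact_mod_cast hα.q_rec m
    linear_combination (q (m + 2) : ℝ) * hα.δ_rec m + a (m + 1) * hα1 + hrec * δ (m + 2)
  have hηj : (q (m + 2) : ℝ) * η j ≤ e + r j * η (j + 2 + k) := by
    have hrR : (q (m + 2) : ℝ) = e * r (j + 1) + f * r j := by exact_mod_cast hQ.trans hr
    have heq : (q (m + 2) : ℝ) * η j = e + r j * (f * η j - e * η (j + 1)) := by
      linear_combination hrR * η j + e * hβ.q_mul_δ_add j
    rw [heq, ← habs]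
    gcongr
    exact le_abs_self _
  refine lt_of_mul_lt_mul_left (a := (q (m + 2) : ℝ)) ?_ (by linarith)
  have hQeq : a (m + 1) * q (m + 1) + q m = e * r (j + 1) + f * r j := by
    rw [← hr, ← hQ, hα.q_rec]
  have hqmono : q m ≤ q (m + 1) := hα.monotone_q (Nat.le_succ m)
  have hea : e ≤ a (m + 1) := by
    by_contra! hlt'
    nlinarith
  have hδ2 := hα.δ_pos (m + 2)
  rcases hea.lt_or_eq with hlt' | heq
  · have : (e : ℝ) + 1 ≤ a (m + 1) := by exact_mod_cast hlt'
    nlinarith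
  · have hle : r j ≤ q m := by
      rw [← heq] at hQeq
      nlinarith
    have hleR : (r j : ℝ) ≤ q m := by exact_mod_cast hle
    rw [hδm, ← heq]
    refine hηj.trans_lt ?_
    have : (r j : ℝ) * η (j + 2 + k) < q m * δ (m + 2) :=
      mul_lt_mul' hleR hδη hηD.le (by linarith)
    linarith

end IsCFExpansion

/-- **Lemma (Kan–Moshchevitin / Remark 6 of [Rud22]).** -/
theorem stmt4 (α β : ℝ) (hα : Irrational α) (hβ : Irrational β)
    (hsum : ∀ z : ℤ, α + β ≠ (z : ℝ)) (hdiff : ∀ z : ℤ, α - β ≠ (z : ℝ)) :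
    ∃ T : ℝ, 0 < T ∧ ∀ m s d : ℕ, 1 ≤ d →
      T < cfDen α m → T < cfDen β s →
      cfDen α (m + 1) = cfDen β (s + d) →
      cfDen β (s - 1) ≤ cfDen α m → cfDen α m < cfDen β s →
      psi α (cfDen α (m + 1) - 1) < psi β (cfDen α (m + 1) - 1) →
      psi α (cfDen α m - 1) > psi β (cfDen α m - 1) := by
  obtain ⟨a, q, p, δ, hA, hq⟩ := exists_isCFExpansion hα
  obtain ⟨b, r, s', η, hB, hr⟩ := exists_isCFExpansion hβ
  refine ⟨1, one_pos, fun m s d hd hm hs hQ hle hlt hpsi => ?_⟩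
  simp only [hq, hr] at hm hs hQ hle hlt hpsi ⊢
  norm_cast at hm hs hQ hle hlt
  obtain ⟨m, rfl⟩ : ∃ n, m = n + 1 :=
    Nat.exists_eq_succ_of_ne_zero (by rintro rfl; simp [hA.q_zero] at hm)
  obtain ⟨s, rfl⟩ : ∃ n, s = n + 1 :=
    Nat.exists_eq_succ_of_ne_zero (by rintro rfl; simp [hB.q_zero] at hs)
  obtain ⟨d, rfl⟩ : ∃ n, d = n + 1 := Nat.exists_eq_succ_of_ne_zero (by lia)
  rw [Nat.add_sub_cancel] at hle
  have hmlt := hA.q_lt_q_succ hm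
  have hrD : r (s + 1) ≤ r (s + 1 + d) := hB.monotone_q (by lia)
  have hQ1 : 1 < q (m + 2) := hm.trans_le (hA.monotone_q (by lia))
  have hβQ : psi β ((q (m + 2) : ℝ) - 1) = η (s + 1 + d) := by
    rw [hQ]
    exact hB.psi_intCast_sub_one (hB.q_lt_q_succ (by rw [← add_assoc] at hQ; lia)) le_rfl
  rw [hβQ, hA.psi_intCast_sub_one (hA.q_lt_q_succ hQ1) le_rfl] at hpsi
  rw [hA.psi_intCast_sub_one hmlt le_rfl]
  rcases hle.lt_or_eq with hlt' | heq
  · rw [hB.psi_intCast_sub_one hlt' hlt.le]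
    exact hA.lt_of_lt_of_q_eq hB (j := s) (k := d) (by rw [hQ]; congr 1; lia) hlt' hlt.le
      (by lia) hpsi
  · obtain ⟨s, rfl⟩ : ∃ n, s = n + 1 :=
      Nat.exists_eq_succ_of_ne_zero (by rintro rfl; simp [hB.q_zero] at heq; lia)
    have hlt' : r s < q (m + 1) := heq ▸ hB.q_lt_q_succ (heq ▸ hm)
    rw [hB.psi_intCast_sub_one hlt' heq.ge]
    exact hA.lt_of_lt_of_q_eq hB (j := s) (k := d + 1) (by rw [hQ]) hlt' heq.ge
      (by rw [show s + 1 + (d + 1) = s + 1 + 1 + d by ring]; lia)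
      (by rwa [show s + 1 + (d + 1) = s + 1 + 1 + d by ring])
end
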